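/- arXiv:1112.4075 — 3 statements merged into one kernel-verified Lean document; each statement's English description precedes it below -/
import Mathlib

section
/- For the planar vector field f̄(v) = (v₂, −b v₁³ − c v₂) with b, c > 0, the field −f̄ and the identity vector field are joined by a nonvanishing linear homotopy on all sufficiently small circles centered at the origin, i.e. the homotopy λ v + (1−λ)(−f̄(v)) has no zeros on such circles for λ ∈ [0,1], and consequently the Poincaré index ind(0, −f̄) equals 1. -/
open Set Filter Function MeasureTheory intervalIntegral

noncomputable section

/-- Embedding of the plane `ℝ × ℝ` into `ℂ`. -/
def toC (v : ℝ × ℝ) : ℂ := ⟨v.1, v.2⟩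

/-- Winding number (topological degree) of the planar vector field `F` along the
loop `γ` traversed over the parameter interval `[0, L]`, computed by the
Cauchy-index formula `(2πi)⁻¹ ∮ d(F∘γ)/(F∘γ)`. -/
def winding (F : ℝ × ℝ → ℝ × ℝ) (γ : ℝ → ℝ × ℝ) (L : ℝ) : ℂ :=
  (2 * Real.pi * Complex.I)⁻¹ *
    ∫ θ in (0:ℝ)..L, deriv (fun s => toC (F (γ s))) θ / toC (F (γ θ))

/-- Counterclockwise circle of radius `r` centered at `v₀`. -/
def circleLoop (v₀ : ℝ × ℝ) (r θ : ℝ) : ℝ × ℝ :=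
  (v₀.1 + r * Real.cos θ, v₀.2 + r * Real.sin θ)

/-- `F` has Poincaré index `n` at an isolated zero `v₀`: the winding number of `F`
along every sufficiently small circle around `v₀` equals `n`. -/
def HasIndex (F : ℝ × ℝ → ℝ × ℝ) (v₀ : ℝ × ℝ) (n : ℤ) : Prop :=
  ∃ r₀ > 0, ∀ r ∈ Ioo (0:ℝ) r₀, winding F (circleLoop v₀ r) (2 * Real.pi) = (n : ℂ)

/-- Divergence `∂F₁/∂x₁ + ∂F₂/∂x₂` of a planar vector field. -/
def divergence (F : ℝ × ℝ → ℝ × ℝ) (x : ℝ × ℝ) : ℝ :=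
  (fderiv ℝ F x (1, 0)).1 + (fderiv ℝ F x (0, 1)).2

/-- `x` is a (global) solution of the nonautonomous system `ẋ = F(t, x)`. -/
def IsSolution (F : ℝ → ℝ × ℝ → ℝ × ℝ) (x : ℝ → ℝ × ℝ) : Prop :=
  ∀ t, HasDerivAt x (F t (x t)) t

/-- The solution `x` of `ẋ = F(t,x)` is asymptotically stable: it is Lyapunov
stable and attracts every solution starting sufficiently close to `x 0`. -/
def IsAsympStable (F : ℝ → ℝ × ℝ → ℝ × ℝ) (x : ℝ → ℝ × ℝ) : Prop :=
  (∀ η > 0, ∃ δ > 0, ∀ y : ℝ → ℝ × ℝ, IsSolution F y → ‖y 0 - x 0‖ < δ →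
    ∀ t ≥ 0, ‖y t - x t‖ < η) ∧
  (∃ δ > 0, ∀ y : ℝ → ℝ × ℝ, IsSolution F y → ‖y 0 - x 0‖ < δ →
    Tendsto (fun t => ‖y t - x t‖) atTop (nhds 0))

/-- Action of the transpose (adjoint) of a linear map of the plane. -/
def adjApply (A : (ℝ × ℝ) →L[ℝ] ℝ × ℝ) (z : ℝ × ℝ) : ℝ × ℝ :=
  ((A (1, 0)).1 * z.1 + (A (1, 0)).2 * z.2,
   (A (0, 1)).1 * z.1 + (A (0, 1)).2 * z.2)

/-- Euclidean scalar product on the plane. -/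
def dotP (v w : ℝ × ℝ) : ℝ := v.1 * w.1 + v.2 * w.2

end

/-- If the segment joining `w` to `z` avoids the origin, then `w / z` lies in the slit plane. -/
lemma div_mem_slitPlane_of_segment_ne_zero {z w : ℂ}
    (h : ∀ t ∈ Icc (0 : ℝ) 1, (t : ℂ) * z + ((1 - t : ℝ) : ℂ) * w ≠ 0) :
    w / z ∈ Complex.slitPlane := by
  have hz : z ≠ 0 := by simpa using h 1 (by simp)
  by_contra hn
  rw [Complex.mem_slitPlane_iff, not_or, not_lt, not_not] at hn
  obtain ⟨hre, him⟩ := hn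
  set x : ℝ := (w / z).re with hx
  have hwz : w / z = (x : ℂ) := Complex.ext (by simp [hx]) (by simpa using him)
  have hw : w = x * z := (div_eq_iff hz).1 hwz
  have hpos : 0 < 1 - x := by linarith
  refine h (-x / (1 - x)) ⟨div_nonneg (by linarith) hpos.le, ?_⟩ ?_
  · rw [div_le_one hpos]
    linarith
  · have hcoef : -x / (1 - x) + (1 - -x / (1 - x)) * x = 0 := by
      field_simp
      ring
    calc _ = ((-x / (1 - x) + (1 - -x / (1 - x)) * x : ℝ) : ℂ) * z := by
          rw [hw]
          push_cast
          ring
      _ = 0 := by rw [hcoef]; simp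

/-- Two closed `C¹` curves joined by a nonvanishing linear homotopy have the same integral of the
logarithmic derivative. -/
lemma integral_logDeriv_eq_of_linear_homotopy {Z G : ℝ → ℂ} {L : ℝ}
    (hZ : ContDiff ℝ 1 Z) (hG : ContDiff ℝ 1 G) (hZL : Z L = Z 0) (hGL : G L = G 0)
    (h : ∀ t ∈ Icc (0 : ℝ) 1, ∀ θ, (t : ℂ) * Z θ + ((1 - t : ℝ) : ℂ) * G θ ≠ 0) :
    ∫ θ in (0 : ℝ)..L, deriv G θ / G θ = ∫ θ in (0 : ℝ)..L, deriv Z θ / Z θ := by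
  have hZ0 : ∀ θ, Z θ ≠ 0 := fun θ => by simpa using h 1 (by simp) θ
  have hG0 : ∀ θ, G θ ≠ 0 := fun θ => by simpa using h 0 (by simp) θ
  have hGi : Continuous fun θ => deriv G θ / G θ :=
    (hG.continuous_deriv le_rfl).div hG.continuous hG0
  have hZi : Continuous fun θ => deriv Z θ / Z θ :=
    (hZ.continuous_deriv le_rfl).div hZ.continuous hZ0
  have hd : ∀ θ, HasDerivAt (fun s => Complex.log (G s / Z s))
      (deriv G θ / G θ - deriv Z θ / Z θ) θ := fun θ => by
    have hmem := div_mem_slitPlane_of_segment_ne_zero fun t ht => h t ht θ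
    have hG' := (hG.differentiable one_ne_zero θ).hasDerivAt
    have hZ' := (hZ.differentiable one_ne_zero θ).hasDerivAt
    have := (hG'.fun_div hZ' (hZ0 θ)).clog_real hmem
    convert this using 1
    have := hZ0 θ
    have := hG0 θ
    field_simp
  have hsub := integral_eq_sub_of_hasDerivAt (a := 0) (b := L) (fun θ _ => hd θ)
    ((hGi.sub hZi).intervalIntegrable 0 L)
  rw [integral_sub (hGi.intervalIntegrable 0 L) (hZi.intervalIntegrable 0 L), hZL, hGL,
    sub_self] at hsub
  exact sub_eq_zero.1 hsub

lemma toC_eq (v : ℝ × ℝ) : toC v = v.1 + v.2 * Complex.I := Complex.mk_eq_add_mul_I _ _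

lemma toC_eq_zero {v : ℝ × ℝ} : toC v = 0 ↔ v = 0 := by
  simp [toC, Complex.ext_iff, Prod.ext_iff]

lemma contDiff_toC {n : WithTop ℕ∞} : ContDiff ℝ n toC := by
  have : toC = fun v : ℝ × ℝ => Complex.ofRealCLM v.1 + Complex.ofRealCLM v.2 * Complex.I :=
    funext toC_eq
  rw [this]
  fun_prop

lemma contDiff_circleLoop {n : WithTop ℕ∞} (v₀ : ℝ × ℝ) (r : ℝ) :
    ContDiff ℝ n (circleLoop v₀ r) := by
  unfold circleLoop
  fun_prop

lemma circleLoop_two_pi (v₀ : ℝ × ℝ) (r : ℝ) :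
    circleLoop v₀ r (2 * Real.pi) = circleLoop v₀ r 0 := by
  simp [circleLoop]

lemma toC_circleLoop_zero (r θ : ℝ) :
    toC (circleLoop 0 r θ) = r * Complex.exp (θ * Complex.I) := by
  rw [toC_eq, Complex.exp_mul_I]
  simp [circleLoop]
  ring

/-- The identity vector field has winding number one along circles around the origin. -/
lemma winding_id_circleLoop {r : ℝ} (hr : r ≠ 0) :
    winding id (circleLoop 0 r) (2 * Real.pi) = 1 := by
  have hd : ∀ θ : ℝ, HasDerivAt (fun s : ℝ => (r : ℂ) * Complex.exp (s * Complex.I))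
      (r * (Complex.exp (θ * Complex.I) * Complex.I)) θ := fun θ => by
    simpa using
      (((Complex.ofRealCLM.hasDerivAt (x := θ)).mul_const Complex.I).cexp).const_mul (r : ℂ)
  have hint : ∀ θ : ℝ, deriv (fun s => toC (id (circleLoop 0 r s))) θ /
      toC (id (circleLoop 0 r θ)) = Complex.I := fun θ => by
    simp only [id, toC_circleLoop_zero, (hd θ).deriv]
    have : (r : ℂ) ≠ 0 := by exact_mod_cast hr
    have := Complex.exp_ne_zero (θ * Complex.I)
    field_simp
  simp only [winding, hint, intervalIntegral.integral_const, sub_zero, Complex.real_smul]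
  push_cast
  exact inv_mul_cancel₀ Complex.two_pi_I_ne_zero

/-- A `C¹` vector field that is linearly homotopic to the identity, without zeros, on a circle
around the origin has winding number one along this circle. -/
lemma winding_circleLoop_eq_one_of_linear_homotopy {F : ℝ × ℝ → ℝ × ℝ} {r : ℝ} (hr : r ≠ 0)
    (hF : ContDiff ℝ 1 F)
    (h : ∀ t ∈ Icc (0 : ℝ) 1, ∀ θ : ℝ,
      t • circleLoop 0 r θ + (1 - t) • F (circleLoop 0 r θ) ≠ 0) :
    winding F (circleLoop 0 r) (2 * Real.pi) = 1 := by
  rw [← winding_id_circleLoop hr, winding, winding]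
  congr 1
  refine integral_logDeriv_eq_of_linear_homotopy
    (contDiff_toC.comp (contDiff_circleLoop 0 r))
    (contDiff_toC.comp (hF.comp (contDiff_circleLoop 0 r)))
    (by rw [circleLoop_two_pi]) (by rw [circleLoop_two_pi]) fun t ht θ h0 => ?_
  refine h t ht θ (toC_eq_zero.1 (Eq.trans ?_ h0))
  simp only [toC_eq, id, Prod.fst_add, Prod.snd_add, Prod.smul_fst, Prod.smul_snd, smul_eq_mul]
  push_cast
  ring

/-- The linear homotopy between the identity and `(x, y) ↦ (-y, b x³ + c y)` vanishes only at the
origin. -/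
lemma duffing_homotopy_eq_zero {b c t x y : ℝ} (hb : 0 < b) (hc : 0 < c)
    (ht : t ∈ Icc (0 : ℝ) 1) (h₁ : t * x - (1 - t) * y = 0)
    (h₂ : t * y + (1 - t) * (b * x ^ 3 + c * y) = 0) : x = 0 ∧ y = 0 := by
  obtain ⟨ht0, ht1⟩ := ht
  rcases ht1.eq_or_lt with rfl | ht1
  · constructor <;> linarith
  have hs : 0 < 1 - t := by linarith
  have hx : x = 0 := by
    by_contra hx
    have hx2 : 0 < x ^ 2 := by positivity
    have hpos : 0 < x ^ 2 * (t ^ 2 + c * t * (1 - t) + b * (1 - t) ^ 2 * x ^ 2) := by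
      positivity
    have : x ^ 2 * (t ^ 2 + c * t * (1 - t) + b * (1 - t) ^ 2 * x ^ 2) = 0 := by
      linear_combination (1 - t) * x * h₂ + (t * x + c * (1 - t) * x) * h₁
    linarith
  refine ⟨hx, ?_⟩
  subst hx
  have : (1 - t) * y = 0 := by linarith
  exact (mul_eq_zero.1 this).resolve_left hs.ne'

/-- **Example 1, the index computation.**
The vector field `-f̄`, where `f̄(v) = (v₂, -b v₁³ - c v₂)` with `b, c > 0`, is
linearly homotopic to the identity on all sufficiently small circles centered at
the origin (the linear homotopy `λ v + (1-λ)(-f̄(v))`, `λ ∈ [0,1]`, has no zeros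
on such circles), and consequently the Poincaré index `ind(0, -f̄)` equals `1`. -/
theorem duffing_index_one
    (b c : ℝ) (hb : 0 < b) (hc : 0 < c)
    (fbar : ℝ × ℝ → ℝ × ℝ)
    (hfbar : ∀ v : ℝ × ℝ, fbar v = (v.2, -b * v.1 ^ 3 - c * v.2)) :
    (∃ r₀ > 0, ∀ r ∈ Ioo (0:ℝ) r₀, ∀ lam ∈ Icc (0:ℝ) 1, ∀ θ : ℝ,
      lam • circleLoop 0 r θ + (1 - lam) • (-(fbar (circleLoop 0 r θ))) ≠ 0) ∧
    HasIndex (fun v => -fbar v) 0 1 := by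
  have key : ∀ r ∈ Ioo (0 : ℝ) 1, ∀ t ∈ Icc (0 : ℝ) 1, ∀ θ : ℝ,
      t • circleLoop 0 r θ + (1 - t) • (-(fbar (circleLoop 0 r θ))) ≠ 0 := by
    intro r hr t ht θ h
    rw [hfbar] at h
    obtain ⟨h₁, h₂⟩ := Prod.ext_iff.1 h
    simp only [Prod.fst_add, Prod.snd_add, Prod.smul_fst, Prod.smul_snd, Prod.fst_neg,
      Prod.snd_neg, Prod.fst_zero, Prod.snd_zero, smul_eq_mul] at h₁ h₂
    obtain ⟨hx, hy⟩ := duffing_homotopy_eq_zero (x := (circleLoop 0 r θ).1)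
      (y := (circleLoop 0 r θ).2) hb hc ht
      (by linear_combination h₁) (by linear_combination h₂)
    have h0 := toC_circleLoop_zero r θ
    rw [toC_eq_zero.2 (Prod.ext hx hy)] at h0
    exact mul_ne_zero (by exact_mod_cast hr.1.ne') (Complex.exp_ne_zero _) h0.symm
  have hF : ContDiff ℝ 1 fun v => -fbar v := by
    simp only [hfbar]
    fun_prop
  refine ⟨⟨1, one_pos, key⟩, 1, one_pos, fun r hr => ?_⟩
  rw [Int.cast_one]
  exact winding_circleLoop_eq_one_of_linear_homotopy hr.1.ne' hF (key r hr)
end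

section
/- Consider the Duffing-type equation ü + ε c u̇ + ε³ a u + ε² b u³ = ε² γ cos(ω t) with constants a, b, c, γ > 0, equivalently the planar system ẋ₁ = ε x₂, ẋ₂ = −ε c x₂ − ε² a x₁ − ε b x₁³ + ε γ cos(ω t) for x = (u, u̇/ε). There exists ε₀ > 0 such that for every ε ∈ (0, ε₀] this system has at least one asymptotically stable 2π/ω-periodic solution x_ε with x_ε → 0 uniformly as ε → 0. -/
open Set Filter Function MeasureTheory intervalIntegral

/-- The solution `t ↦ ∫_{-∞}^t e^{-k(t-s)} f(s) ds` of `w' = f - k w` which is bounded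
whenever `f` is. -/
noncomputable def boundedSol (k : ℝ) (f : ℝ → ℝ) (t : ℝ) : ℝ :=
  ∫ s in Iic (0 : ℝ), Real.exp (k * s) * f (t + s)

theorem integrableOn_exp_mul_of_bounded {k M : ℝ} (hk : 0 < k) {f : ℝ → ℝ} (hf : Continuous f)
    (hM : ∀ t, |f t| ≤ M) (t : ℝ) : IntegrableOn (fun s => Real.exp (k * s) * f s) (Iic t) := by
  refine ((integrableOn_exp_mul_Iic hk t).mul_const M).mono' (by fun_prop) ?_
  refine Eventually.of_forall fun s => ?_
  rw [norm_mul, Real.norm_eq_abs, Real.norm_eq_abs, Real.abs_exp]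
  gcongr
  exact hM s

theorem boundedSol_eq (k : ℝ) (f : ℝ → ℝ) (t : ℝ) :
    boundedSol k f t = Real.exp (-k * t) * ∫ s in Iic t, Real.exp (k * s) * f s := by
  have h := (measurePreserving_add_left volume t).setIntegral_preimage_emb
    (MeasurableEquiv.addLeft t).measurableEmbedding
    (fun s => Real.exp (k * s) * f s) (Iic t)
  rw [← h, ← MeasureTheory.integral_const_mul, boundedSol]
  have : (fun x => t + x) ⁻¹' Iic t = Iic 0 := by ext; simp
  rw [this]
  congr 1 with s
  rw [← mul_assoc, ← Real.exp_add]
  ring_nf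

theorem boundedSol_hasDerivAt {k M : ℝ} (hk : 0 < k) {f : ℝ → ℝ} (hf : Continuous f)
    (hM : ∀ t, |f t| ≤ M) (t : ℝ) :
    HasDerivAt (boundedSol k f) (f t - k * boundedSol k f t) t := by
  have hint := integrableOn_exp_mul_of_bounded hk hf hM
  have hg : Continuous fun s => Real.exp (k * s) * f s := by fun_prop
  have h0 : boundedSol k f = fun t => Real.exp (-k * t) *
      ((∫ s in Iic (0 : ℝ), Real.exp (k * s) * f s)
        + ∫ s in (0 : ℝ)..t, Real.exp (k * s) * f s) := by
    funext t
    rw [boundedSol_eq, ← integral_Iic_sub_Iic (hint 0) (hint t)]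
    ring
  have h1 : HasDerivAt (fun t : ℝ => Real.exp (-k * t)) (Real.exp (-k * t) * (-k)) t := by
    simpa using ((hasDerivAt_id t).const_mul (-k)).exp
  have h2 := (hg.integral_hasStrictDerivAt 0 t).hasDerivAt
  have h3 := h1.mul (h2.const_add (∫ s in Iic (0 : ℝ), Real.exp (k * s) * f s))
  rw [h0]
  convert! h3 using 1
  have : Real.exp (-k * t) * Real.exp (k * t) = 1 := by rw [← Real.exp_add]; simp
  linear_combination (-f t) * this

theorem abs_boundedSol_sub_le {k M N D : ℝ} (hk : 0 < k) {f g : ℝ → ℝ} (hf : Continuous f)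
    (hg : Continuous g) (hM : ∀ t, |f t| ≤ M) (hN : ∀ t, |g t| ≤ N)
    (hD : ∀ t, |f t - g t| ≤ D) (t : ℝ) :
    |boundedSol k f t - boundedSol k g t| ≤ D / k := by
  have h1 := integrableOn_exp_mul_of_bounded hk (hf.comp (continuous_const_add t))
    (fun s => hM (t + s)) 0
  have h2 := integrableOn_exp_mul_of_bounded hk (hg.comp (continuous_const_add t))
    (fun s => hN (t + s)) 0
  have h3 : boundedSol k f t - boundedSol k g t
      = ∫ s in Iic (0 : ℝ), Real.exp (k * s) * (f (t + s) - g (t + s)) := by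
    refine (MeasureTheory.integral_sub h1 h2).symm.trans ?_
    congr 1 with s
    simp only [Function.comp]
    ring
  have h4 : ∫ s in Iic (0 : ℝ), Real.exp (k * s) * D = D / k := by
    rw [MeasureTheory.integral_mul_const, integral_exp_mul_Iic hk]
    simp
    ring
  rw [h3, ← h4, ← Real.norm_eq_abs]
  refine norm_integral_le_of_norm_le ((integrableOn_exp_mul_Iic hk 0).mul_const D) ?_
  refine Eventually.of_forall fun s => ?_
  rw [norm_mul, Real.norm_eq_abs, Real.norm_eq_abs, Real.abs_exp]
  gcongr
  exact hD _

theorem abs_boundedSol_le {k M : ℝ} (hk : 0 < k) {f : ℝ → ℝ} (hf : Continuous f)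
    (hM : ∀ t, |f t| ≤ M) (t : ℝ) : |boundedSol k f t| ≤ M / k := by
  have h := abs_boundedSol_sub_le (g := fun _ => 0) (N := 0) hk hf continuous_const hM
    (by simp) (by simpa using hM) t
  simpa [boundedSol] using h

theorem boundedSol_continuous {k M : ℝ} (hk : 0 < k) {f : ℝ → ℝ} (hf : Continuous f)
    (hM : ∀ t, |f t| ≤ M) : Continuous (boundedSol k f) :=
  continuous_iff_continuousAt.2 fun t => (boundedSol_hasDerivAt hk hf hM t).continuousAt

theorem boundedSol_periodic (k : ℝ) {f : ℝ → ℝ} {T : ℝ} (hf : Periodic f T) :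
    Periodic (boundedSol k f) T := by
  intro t
  simp only [boundedSol]
  congr 1 with s
  rw [← hf (t + s)]
  ring_nf

/-- A small periodic solution of `w' = z - k w`, `z' = h (w + p) - k z` for a nonlinearity `h`
with `h 0 = 0` whose Lipschitz constant is less than `k ^ 2`. -/
theorem exists_periodic_fixedPoint {k L r P T : ℝ} (hk : 0 < k) (hL : 0 ≤ L) (hr : 0 ≤ r)
    (hLk : L < k ^ 2) {h p : ℝ → ℝ} (hh : Continuous h) (hp : Continuous p)
    (hpT : Periodic p T) (hpP : ∀ t, |p t| ≤ P) (h0 : h 0 = 0)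
    (hlip : ∀ x y, |x| ≤ r + P → |y| ≤ r + P → |h x - h y| ≤ L * |x - y|)
    (hself : L * (r + P) ≤ k ^ 2 * r) :
    ∃ w z : ℝ → ℝ, Periodic w T ∧ Periodic z T ∧ (∀ t, |w t| ≤ r) ∧
      (∀ t, |z t| ≤ L * (r + P) / k) ∧ (∀ t, HasDerivAt w (z t - k * w t) t) ∧
      ∀ t, HasDerivAt z (h (w t + p t) - k * z t) t := by
  have hP : 0 ≤ P := (abs_nonneg _).trans (hpP 0)
  let S : Set (BoundedContinuousFunction ℝ ℝ) := {w | (∀ t, |w t| ≤ r) ∧ ∀ t, w (t + T) = w t}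
  have hSc : IsClosed S := by
    have ev : ∀ t : ℝ, Continuous fun w : BoundedContinuousFunction ℝ ℝ => w t :=
      fun t => continuous_eval_const t
    refine IsClosed.inter (s₁ := {w : BoundedContinuousFunction ℝ ℝ | ∀ t, |w t| ≤ r})
      (s₂ := {w : BoundedContinuousFunction ℝ ℝ | ∀ t, w (t + T) = w t}) ?_ ?_
    · simp only [ofPred_forall]
      exact isClosed_iInter fun t => isClosed_le (ev t).abs continuous_const
    · simp only [ofPred_forall]
      exact isClosed_iInter fun t => isClosed_eq (ev (t + T)) (ev t)
  have : CompleteSpace S := hSc.completeSpace_coe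
  have : Nonempty S := ⟨⟨0, by simpa [S] using hr⟩⟩
  have hb : ∀ w : S, ∀ t, |w.1 t + p t| ≤ r + P := fun w t =>
    (abs_add_le _ _).trans (add_le_add (w.2.1 t) (hpP t))
  have hgc : ∀ w : S, Continuous fun t => h (w.1 t + p t) := fun w =>
    hh.comp (w.1.continuous.add hp)
  have hgb : ∀ w : S, ∀ t, |h (w.1 t + p t)| ≤ L * (r + P) := fun w t => by
    have := hlip _ 0 (hb w t) (by simpa using add_nonneg hr hP)
    rw [h0, sub_zero, sub_zero] at this
    exact this.trans (mul_le_mul_of_nonneg_left (hb w t) hL)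
  have hzc : ∀ w : S, Continuous (boundedSol k fun t => h (w.1 t + p t)) := fun w =>
    boundedSol_continuous hk (hgc w) (hgb w)
  have hzb : ∀ w : S, ∀ t, |boundedSol k (fun t => h (w.1 t + p t)) t| ≤ L * (r + P) / k :=
    fun w => abs_boundedSol_le hk (hgc w) (hgb w)
  have hzT : ∀ w : S, Periodic (boundedSol k fun t => h (w.1 t + p t)) T := fun w =>
    boundedSol_periodic k fun t => by
      rw [w.2.2, hpT]
  have hwb : ∀ w : S, ∀ t,
      |boundedSol k (boundedSol k fun t => h (w.1 t + p t)) t| ≤ r := fun w t => by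
    refine (abs_boundedSol_le hk (hzc w) (hzb w) t).trans ?_
    rw [div_div, div_le_iff₀ (by positivity)]
    linarith
  let Φ : S → S := fun w =>
    ⟨BoundedContinuousFunction.ofNormedAddCommGroup
      (boundedSol k (boundedSol k fun t => h (w.1 t + p t)))
      (boundedSol_continuous hk (hzc w) (hzb w)) r (hwb w),
      hwb w, boundedSol_periodic k (hzT w)⟩
  have hΦ : ContractingWith (L / k ^ 2).toNNReal Φ := by
    refine ⟨?_, LipschitzWith.of_dist_le_mul fun w w' => ?_⟩
    · rw [Real.toNNReal_lt_one, div_lt_one (by positivity)]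
      exact hLk
    · rw [Real.coe_toNNReal _ (by positivity), Subtype.dist_eq,
        BoundedContinuousFunction.dist_le (by positivity)]
      intro t
      have h1 : ∀ t, |h (w.1 t + p t) - h (w'.1 t + p t)| ≤ L * dist w w' := fun t => by
        refine (hlip _ _ (hb w t) (hb w' t)).trans (mul_le_mul_of_nonneg_left ?_ hL)
        rw [add_sub_add_right_eq_sub]
        exact BoundedContinuousFunction.dist_coe_le_dist (f := w.1) (g := w'.1) t
      have h2 := abs_boundedSol_sub_le hk (hgc w) (hgc w') (hgb w) (hgb w') h1
      have h3 := abs_boundedSol_sub_le hk (hzc w) (hzc w') (hzb w) (hzb w') h2 t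
      refine h3.trans (le_of_eq ?_)
      field_simp
  obtain ⟨w, hw⟩ : ∃ w, Φ w = w := ⟨_, hΦ.fixedPoint_isFixedPt⟩
  have hw' : ⇑w.1 = boundedSol k (boundedSol k fun t => h (w.1 t + p t)) :=
    (congrArg (fun v : S => ⇑v.1) hw).symm
  refine ⟨w.1, boundedSol k fun t => h (w.1 t + p t), w.2.2, hzT w, w.2.1, hzb w, fun t => ?_,
    boundedSol_hasDerivAt hk (hgc w) (hgb w)⟩
  have := boundedSol_hasDerivAt hk (hzc w) (hzb w) t
  rwa [← hw'] at this

/-- A nonnegative function satisfying `V' ≤ -β V` wherever `V ≤ η`, and starting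
below `η`, decays exponentially. -/
theorem le_mul_exp_of_local_decay {V V' : ℝ → ℝ} {β η : ℝ} (hβ : 0 < β) (hη : 0 < η)
    (hV : ∀ t, HasDerivAt V (V' t) t) (hdec : ∀ t, V t ≤ η → V' t ≤ -β * V t)
    (h0 : V 0 ≤ η) {t : ℝ} (ht : 0 ≤ t) : V t ≤ V 0 * Real.exp (-β * t) := by
  have hle : ∀ t, 0 ≤ t → V t ≤ η := fun t ht =>
    image_le_of_deriv_right_lt_deriv_boundary (f' := V') (B := fun _ => η) (B' := fun _ => 0)
      (fun s _ => (hV s).continuousAt.continuousWithinAt)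
      (fun s _ => (hV s).hasDerivWithinAt) h0 (fun s => hasDerivAt_const s η)
      (fun s _ hs => by
        have := hdec s hs.le
        rw [hs] at this
        nlinarith) (right_mem_Icc.2 ht)
  have hE : ∀ s, HasDerivAt (fun s => V s * Real.exp (β * s))
      (V' s * Real.exp (β * s) + V s * (Real.exp (β * s) * β)) s := fun s => by
    have := ((hasDerivAt_id s).const_mul β).exp
    simp only [id, mul_one] at this
    exact (hV s).mul this
  have hanti : AntitoneOn (fun s => V s * Real.exp (β * s)) (Ici 0) := by
    refine antitoneOn_of_deriv_nonpos (convex_Ici 0)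
      (fun s _ => (hE s).continuousAt.continuousWithinAt)
      (fun s _ => (hE s).differentiableAt.differentiableWithinAt) fun s hs => ?_
    rw [interior_Ici] at hs
    rw [(hE s).deriv]
    have h1 := hdec s (hle s (le_of_lt hs))
    have h2 := Real.exp_pos (β * s)
    nlinarith
  have h1 := hanti self_mem_Ici (mem_Ici.2 ht) ht
  simp only [mul_zero, Real.exp_zero, mul_one] at h1
  have h2 : Real.exp (β * t) * Real.exp (-β * t) = 1 := by rw [← Real.exp_add]; simp
  calc V t = V t * Real.exp (β * t) * Real.exp (-β * t) := by rw [mul_assoc, h2, mul_one]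
    _ ≤ _ := by gcongr

/-- Lyapunov function for differences of solutions of a damped oscillator. -/
noncomputable def dampedEnergy (c d e : ℝ) : ℝ := e ^ 2 + c * d * e + c ^ 2 / 2 * d ^ 2

theorem damped_dissipation {c κ κ₀ α : ℝ} (hc : 0 < c) (hκ₀ : 0 < κ₀) (hκ : κ₀ ≤ κ)
    (hκc : κ ≤ c ^ 2 / 4) (hα : 0 ≤ α) (hα₁ : α ≤ c / 3) (hα₂ : α * (2 * c) ≤ κ₀) (d e : ℝ) :
    -c * e ^ 2 - 2 * κ * d * e - c * κ * d ^ 2 ≤ -α * dampedEnergy c d e := by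
  have h1 : -2 * κ * d * e ≤ κ * (c / 2 * d ^ 2 + 2 / c * e ^ 2) := by
    have : c / 2 * d ^ 2 + 2 / c * e ^ 2 + 2 * d * e = (c * d + 2 * e) ^ 2 / (2 * c) := by
      field_simp
      ring
    have h : 0 ≤ (c * d + 2 * e) ^ 2 / (2 * c) := by positivity
    nlinarith
  have h2 : κ * (2 / c * e ^ 2) ≤ c / 2 * e ^ 2 := by
    have : c / 2 * e ^ 2 = c ^ 2 / 4 * (2 / c * e ^ 2) := by field_simp; ring
    rw [this]
    gcongr
  have h3 : dampedEnergy c d e ≤ 3 / 2 * e ^ 2 + c ^ 2 * d ^ 2 := by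
    unfold dampedEnergy
    nlinarith [sq_nonneg (c * d - e)]
  have h4 : α * dampedEnergy c d e ≤ α * (3 / 2 * e ^ 2 + c ^ 2 * d ^ 2) := by gcongr
  have h5 : α * (3 / 2 * e ^ 2) ≤ c / 3 * (3 / 2 * e ^ 2) := by gcongr
  have h6 : α * (2 * c) * (c / 2 * d ^ 2) ≤ κ * (c / 2 * d ^ 2) := by gcongr; linarith
  nlinarith

theorem sq_fst_le_dampedEnergy (c d e : ℝ) : c ^ 2 / 4 * d ^ 2 ≤ dampedEnergy c d e := by
  unfold dampedEnergy
  nlinarith [sq_nonneg (e + c * d / 2)]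

theorem sq_snd_le_dampedEnergy (c d e : ℝ) : e ^ 2 ≤ 2 * dampedEnergy c d e := by
  unfold dampedEnergy
  nlinarith [sq_nonneg (e + c * d)]

theorem norm_sq_le_dampedEnergy {c : ℝ} (hc : 0 < c) (v : ℝ × ℝ) :
    ‖v‖ ^ 2 ≤ (4 / c ^ 2 + 2) * dampedEnergy c v.1 v.2 := by
  have h1 := sq_fst_le_dampedEnergy c v.1 v.2
  have h2 := sq_snd_le_dampedEnergy c v.1 v.2
  have h3 : 0 ≤ dampedEnergy c v.1 v.2 := le_trans (by positivity) h1
  have h4 : v.1 ^ 2 ≤ 4 / c ^ 2 * dampedEnergy c v.1 v.2 := by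
    rw [div_mul_eq_mul_div, le_div_iff₀ (by positivity)]
    linarith
  have h5 : 0 ≤ 4 / c ^ 2 * dampedEnergy c v.1 v.2 := by positivity
  rw [Prod.norm_def, Real.norm_eq_abs, Real.norm_eq_abs]
  rcases max_cases |v.1| |v.2| with ⟨h, _⟩ | ⟨h, _⟩ <;> rw [h, sq_abs] <;> nlinarith

theorem dampedEnergy_le_norm_sq {c : ℝ} (hc : 0 < c) (v : ℝ × ℝ) :
    dampedEnergy c v.1 v.2 ≤ (3 / 2 + c ^ 2) * ‖v‖ ^ 2 := by
  have h1 : v.1 ^ 2 ≤ ‖v‖ ^ 2 := sq_le_sq.2 ((norm_fst_le v).trans (le_abs_self _))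
  have h2 : v.2 ^ 2 ≤ ‖v‖ ^ 2 := sq_le_sq.2 ((norm_snd_le v).trans (le_abs_self _))
  have h3 : c ^ 2 * v.1 ^ 2 ≤ c ^ 2 * ‖v‖ ^ 2 := by gcongr
  unfold dampedEnergy
  nlinarith [sq_nonneg (c * v.1 - v.2)]

/-- A solution of the Duffing-type system is asymptotically stable if its first component
is small relative to the damping. -/
theorem duffing_isAsympStable {a b c γ ω ε σ : ℝ} (ha : 0 < a) (hb : 0 < b) (hc : 0 < c)
    (hε : 0 < ε) (hσ : 0 < σ) (hsmall : ε * a + 12 * b * σ ^ 2 ≤ c ^ 2 / 4)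
    {F : ℝ → ℝ × ℝ → ℝ × ℝ}
    (hF : ∀ t x, F t x = (ε * x.2, -ε * c * x.2 - ε ^ 2 * a * x.1 - ε * b * x.1 ^ 3
        + ε * γ * Real.cos (ω * t)))
    {x : ℝ → ℝ × ℝ} (hx : IsSolution F x) (hxσ : ∀ t, |(x t).1| ≤ σ) :
    IsAsympStable F x := by
  obtain ⟨α, hα, hα₁, hα₂⟩ : ∃ α : ℝ, 0 < α ∧ α ≤ c / 3 ∧ α * (2 * c) ≤ ε * a :=
    ⟨min (c / 3) (ε * a / (2 * c)), lt_min (by positivity) (by positivity), min_le_left _ _,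
      (le_div_iff₀ (by positivity)).1 (min_le_right _ _)⟩
  have decay : ∀ y : ℝ → ℝ × ℝ, IsSolution F y →
      (3 / 2 + c ^ 2) * ‖y 0 - x 0‖ ^ 2 ≤ c ^ 2 / 4 * σ ^ 2 → ∀ t ≥ 0,
      ‖y t - x t‖ ^ 2 ≤ (4 / c ^ 2 + 2) * ((3 / 2 + c ^ 2) * ‖y 0 - x 0‖ ^ 2)
        * Real.exp (-(ε * α) * t) := by
    intro y hy hy0 t ht
    have hfst : ∀ z : ℝ → ℝ × ℝ, IsSolution F z → ∀ t,
        HasDerivAt (fun t => (z t).1) (ε * (z t).2) t := fun z hz t => by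
      have := (hz t).fst
      rwa [hF] at this
    have hsnd : ∀ z : ℝ → ℝ × ℝ, IsSolution F z → ∀ t, HasDerivAt (fun t => (z t).2)
        (-ε * c * (z t).2 - ε ^ 2 * a * (z t).1 - ε * b * (z t).1 ^ 3
        + ε * γ * Real.cos (ω * t)) t := fun z hz t => by
      have := (hz t).snd
      rwa [hF] at this
    have hV : ∀ t, HasDerivAt (fun t => dampedEnergy c (y t - x t).1 (y t - x t).2)
        (ε * (-c * (y t - x t).2 ^ 2
          - 2 * (ε * a + b * ((y t).1 ^ 2 + (y t).1 * (x t).1 + (x t).1 ^ 2))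
            * (y t - x t).1 * (y t - x t).2
          - c * (ε * a + b * ((y t).1 ^ 2 + (y t).1 * (x t).1 + (x t).1 ^ 2))
            * (y t - x t).1 ^ 2)) t := fun t => by
      have hd := (hfst y hy t).sub (hfst x hx t)
      have he := (hsnd y hy t).sub (hsnd x hx t)
      have := ((he.pow 2).add ((hd.const_mul c).mul he)).add ((hd.pow 2).const_mul (c ^ 2 / 2))
      convert! this using 1
      simp only [Prod.fst_sub, Prod.snd_sub, Pi.sub_apply]
      ring
    have h := le_mul_exp_of_local_decay (β := ε * α) (η := c ^ 2 / 4 * σ ^ 2) (by positivity)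
      (by positivity) hV (fun t hVt => ?_)
      ((dampedEnergy_le_norm_sq hc _).trans hy0) ht
    · refine (norm_sq_le_dampedEnergy hc _).trans ?_
      rw [mul_assoc]
      refine mul_le_mul_of_nonneg_left (h.trans ?_) (by positivity)
      exact mul_le_mul_of_nonneg_right (dampedEnergy_le_norm_sq hc _) (Real.exp_pos _).le
    · have hd : (y t - x t).1 ^ 2 ≤ σ ^ 2 := by
        have := (sq_fst_le_dampedEnergy c _ _).trans hVt
        exact le_of_mul_le_mul_left this (by positivity)
      have hx2 : (x t).1 ^ 2 ≤ σ ^ 2 := sq_le_sq.2 ((hxσ t).trans (le_abs_self σ))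
      rw [Prod.fst_sub] at hd
      have hs0 : 0 ≤ (y t).1 ^ 2 + (y t).1 * (x t).1 + (x t).1 ^ 2 := by
        nlinarith [sq_nonneg ((y t).1 + (x t).1)]
      have hs : (y t).1 ^ 2 + (y t).1 * (x t).1 + (x t).1 ^ 2 ≤ 12 * σ ^ 2 := by
        nlinarith [sq_nonneg ((y t).1 - 2 * (x t).1)]
      have := damped_dissipation (κ := ε * a + b * ((y t).1 ^ 2 + (y t).1 * (x t).1 + (x t).1 ^ 2))
        hc (mul_pos hε ha) (le_add_of_nonneg_right (by positivity)) (by nlinarith) hα.le hα₁ hα₂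
        (y t - x t).1 (y t - x t).2
      nlinarith
  have cC : 0 < 3 / 2 + c ^ 2 := by positivity
  have cD : 0 < 4 / c ^ 2 + 2 := by positivity
  have sq_small : ∀ m : ℝ, 0 < m → ∃ δ > 0, ∀ n : ℝ, 0 ≤ n → n < δ →
      (3 / 2 + c ^ 2) * n ^ 2 < m := by
    intro m hm
    refine ⟨Real.sqrt (m / (3 / 2 + c ^ 2)), Real.sqrt_pos.2 (by positivity), fun n hn hlt => ?_⟩
    rw [Real.lt_sqrt hn, lt_div_iff₀ cC] at hlt
    linarith
  obtain ⟨δ₀, hδ₀, hδ₀'⟩ := sq_small (c ^ 2 / 4 * σ ^ 2) (by positivity)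
  refine ⟨fun η hη => ?_, δ₀, hδ₀, fun y hy hy0 => ?_⟩
  · obtain ⟨δ₁, hδ₁, hδ₁'⟩ := sq_small (η ^ 2 / (4 / c ^ 2 + 2)) (by positivity)
    refine ⟨min δ₀ δ₁, lt_min hδ₀ hδ₁, fun y hy hy0 t ht => ?_⟩
    have h1 := decay y hy (hδ₀' _ (norm_nonneg _) (hy0.trans_le (min_le_left _ _))).le t ht
    have h2 := hδ₁' _ (norm_nonneg _) (hy0.trans_le (min_le_right _ _))
    rw [lt_div_iff₀ cD] at h2
    refine lt_of_pow_lt_pow_left₀ 2 hη.le (h1.trans_lt ?_)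
    have h3 : Real.exp (-(ε * α) * t) ≤ 1 := by
      rw [Real.exp_le_one_iff]
      nlinarith [mul_pos hε hα]
    calc _ ≤ (4 / c ^ 2 + 2) * ((3 / 2 + c ^ 2) * ‖y 0 - x 0‖ ^ 2) * 1 := by gcongr
      _ < η ^ 2 := by linarith
  · have h1 := decay y hy (hδ₀' _ (norm_nonneg _) hy0).le
    have h2 : Tendsto (fun t => (4 / c ^ 2 + 2) * ((3 / 2 + c ^ 2) * ‖y 0 - x 0‖ ^ 2)
        * Real.exp (-(ε * α) * t)) atTop (nhds 0) := by
      have : Tendsto (fun t => Real.exp (-(ε * α) * t)) atTop (nhds 0) :=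
        Real.tendsto_exp_atBot.comp
          (tendsto_id.const_mul_atTop_of_neg (neg_lt_zero.2 (mul_pos hε hα)))
      simpa using this.const_mul ((4 / c ^ 2 + 2) * ((3 / 2 + c ^ 2) * ‖y 0 - x 0‖ ^ 2))
    have h3 : Tendsto (fun t => ‖y t - x t‖ ^ 2) atTop (nhds 0) :=
      squeeze_zero' (Eventually.of_forall fun t => by positivity)
        ((eventually_ge_atTop 0).mono h1) h2
    simpa [Real.sqrt_sq] using h3.sqrt

/-- A small periodic solution of the Duffing-type system. -/
theorem exists_duffing_periodic {a b lam γ ω ε C₁ : ℝ} (ha : 0 < a) (hb : 0 < b)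
    (hlam : 0 < lam) (hγ : 0 < γ) (hω : 0 < ω) (hε : 0 < ε) (hε₁ : ε ≤ 1)
    (hC₁ : C₁ = 2 * γ * lam ^ 2 / (a * ω ^ 2) + 2 * γ / ω ^ 2)
    (hsmall : ε * a + 3 * b * (ε * C₁) ^ 2 ≤ lam ^ 2)
    {F : ℝ → ℝ × ℝ → ℝ × ℝ}
    (hF : ∀ t x, F t x = (ε * x.2, -ε * (2 * lam) * x.2 - ε ^ 2 * a * x.1 - ε * b * x.1 ^ 3
        + ε * γ * Real.cos (ω * t))) :
    ∃ x : ℝ → ℝ × ℝ, IsSolution F x ∧ Periodic x (2 * Real.pi / ω) ∧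
      (∀ t, |(x t).1| ≤ ε * C₁) ∧
      ∀ t, |(x t).2| ≤ ε * (2 * lam * C₁ + γ * (lam + ω) / ω ^ 2) := by
  have hcT : Periodic (fun t => Real.cos (ω * t)) (2 * Real.pi / ω) := fun t => by
    simp only [mul_add, mul_div_cancel₀ _ hω.ne', Real.cos_add_two_pi]
  have hsT : Periodic (fun t => Real.sin (ω * t)) (2 * Real.pi / ω) := fun t => by
    simp only [mul_add, mul_div_cancel₀ _ hω.ne', Real.sin_add_two_pi]
  have hcd : ∀ t, HasDerivAt (fun t => Real.cos (ω * t)) (-Real.sin (ω * t) * ω) t := fun t => by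
    simpa using ((hasDerivAt_id t).const_mul ω).cos
  have hsd : ∀ t, HasDerivAt (fun t => Real.sin (ω * t)) (Real.cos (ω * t) * ω) t := fun t => by
    simpa using ((hasDerivAt_id t).const_mul ω).sin
  obtain ⟨D, hD⟩ : ∃ D, D = lam ^ 2 * ε ^ 2 + ω ^ 2 := ⟨_, rfl⟩
  have hDpos : 0 < D := by rw [hD]; positivity
  have hDω : ω ^ 2 ≤ D := by rw [hD]; linarith [show 0 ≤ lam ^ 2 * ε ^ 2 by positivity]
  -- the bounded responses of `ε⁻¹ d/dt + lam` and of its square to the periodic forcing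
  obtain ⟨p₁, hp₁⟩ : ∃ p₁ : ℝ → ℝ, p₁ = fun t =>
      γ * ((lam * ε ^ 2 * Real.cos (ω * t) + ε * ω * Real.sin (ω * t)) / D) := ⟨_, rfl⟩
  obtain ⟨p₂, hp₂⟩ : ∃ p₂ : ℝ → ℝ, p₂ = fun t =>
      γ * (ε ^ 2 * ((lam ^ 2 * ε ^ 2 - ω ^ 2) * Real.cos (ω * t)
        + 2 * lam * ε * ω * Real.sin (ω * t)) / D ^ 2) := ⟨_, rfl⟩
  have hd₁ : ∀ t, HasDerivAt p₁ (ε * (γ * Real.cos (ω * t) - lam * p₁ t)) t := fun t => by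
    rw [hp₁]
    have := ((((hcd t).const_mul (lam * ε ^ 2)).add ((hsd t).const_mul (ε * ω))).div_const
      D).const_mul γ
    convert! this using 1
    field_simp
    rw [hD]
    ring
  have hd₂ : ∀ t, HasDerivAt p₂ (ε * (p₁ t - lam * p₂ t)) t := fun t => by
    rw [hp₂, hp₁]
    have := (((((hcd t).const_mul (lam ^ 2 * ε ^ 2 - ω ^ 2)).add
      ((hsd t).const_mul (2 * lam * ε * ω))).const_mul (ε ^ 2)).div_const (D ^ 2)).const_mul γ
    convert! this using 1
    field_simp
    rw [hD]
    ring
  have hT₁ : Periodic p₁ (2 * Real.pi / ω) := fun t => by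
    have h1 := hcT t
    have h2 := hsT t
    simp only at h1 h2
    simp only [hp₁, h1, h2]
  have hT₂ : Periodic p₂ (2 * Real.pi / ω) := fun t => by
    have h1 := hcT t
    have h2 := hsT t
    simp only at h1 h2
    simp only [hp₂, h1, h2]
  have hcomb : ∀ A B θ : ℝ, |A * Real.cos θ + B * Real.sin θ| ≤ |A| + |B| := fun A B θ => by
    refine (abs_add_le _ _).trans (add_le_add ?_ ?_) <;> rw [abs_mul]
    · exact mul_le_of_le_one_right (abs_nonneg _) (Real.abs_cos_le_one _)
    · exact mul_le_of_le_one_right (abs_nonneg _) (Real.abs_sin_le_one _)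
  have hb₁ : ∀ t, |p₁ t| ≤ ε * (γ * (lam + ω) / ω ^ 2) := fun t => by
    have h1 := hcomb (lam * ε ^ 2) (ε * ω) (ω * t)
    rw [abs_of_pos (show 0 < lam * ε ^ 2 by positivity),
      abs_of_pos (show 0 < ε * ω by positivity)] at h1
    rw [hp₁]
    simp only
    rw [abs_mul, abs_div, abs_of_pos hγ, abs_of_pos hDpos]
    have h2 : lam * ε ^ 2 + ε * ω ≤ ε * (lam + ω) := by
      nlinarith [mul_le_mul_of_nonneg_left hε₁ (mul_pos hlam hε).le]
    calc _ ≤ γ * ((ε * (lam + ω)) / ω ^ 2) := by gcongr; exact h1.trans h2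
      _ = _ := by ring
  have hb₂ : ∀ t, |p₂ t| ≤ 2 * γ * ε ^ 2 / ω ^ 2 := fun t => by
    have h1 := hcomb (lam ^ 2 * ε ^ 2 - ω ^ 2) (2 * lam * ε * ω) (ω * t)
    rw [abs_of_pos (show 0 < 2 * lam * ε * ω by positivity)] at h1
    have h3 : |lam ^ 2 * ε ^ 2 - ω ^ 2| ≤ D := by
      rw [hD, abs_le]
      constructor <;> nlinarith [sq_nonneg (lam * ε), sq_nonneg ω]
    have h4 : 2 * lam * ε * ω ≤ D := by rw [hD]; nlinarith [sq_nonneg (lam * ε - ω)]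
    rw [hp₂]
    simp only
    rw [abs_mul, abs_div, abs_mul, abs_of_pos hγ, abs_of_pos (pow_pos hDpos 2),
      abs_of_pos (pow_pos hε 2)]
    calc _ ≤ γ * (ε ^ 2 * (2 * D) / D ^ 2) := by gcongr; linarith
      _ = 2 * γ * ε ^ 2 / D := by field_simp
      _ ≤ _ := by gcongr
  obtain ⟨r, hr⟩ : ∃ r, r = 2 * γ * ε * lam ^ 2 / (a * ω ^ 2) := ⟨_, rfl⟩
  obtain ⟨P, hP⟩ : ∃ P, P = 2 * γ * ε ^ 2 / ω ^ 2 := ⟨_, rfl⟩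
  have hr0 : 0 < r := by rw [hr]; positivity
  have hP0 : 0 < P := by rw [hP]; positivity
  have hPr : P * lam ^ 2 = ε * a * r := by rw [hP, hr]; field_simp
  have hR : r + P ≤ ε * C₁ := by
    have : 2 * γ * ε ^ 2 / ω ^ 2 ≤ 2 * γ * (ε * 1) / ω ^ 2 := by
      rw [sq ε]
      gcongr
    rw [hr, hP, hC₁]
    refine (add_le_add_right this _).trans (le_of_eq ?_)
    ring
  have hR2 : (r + P) ^ 2 ≤ (ε * C₁) ^ 2 := by gcongr
  have hlip : ε * a + 3 * b * (r + P) ^ 2 ≤ lam ^ 2 := by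
    refine le_trans ?_ hsmall
    gcongr
  have hL : 0 ≤ lam ^ 2 - ε * a := by
    have : 0 ≤ 3 * b * (r + P) ^ 2 := by positivity
    linarith
  have hεa : 0 < ε * a := mul_pos hε ha
  obtain ⟨w, z, hwT, hzT, hw, hz, hwd, hzd⟩ := exists_periodic_fixedPoint (k := ε * lam)
    (L := ε ^ 2 * (lam ^ 2 - ε * a)) (r := r) (P := P) (p := p₂)
    (h := fun x => ε ^ 2 * ((lam ^ 2 - ε * a) * x - b * x ^ 3)) (by positivity) (by positivity)
    hr0.le (by rw [mul_pow]; gcongr; linarith) (by fun_prop)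
    (continuous_iff_continuousAt.2 fun t => (hd₂ t).continuousAt) hT₂ (by rwa [hP]) (by simp)
    (fun x y hx hy => by
      have hx2 : x ^ 2 ≤ (r + P) ^ 2 := sq_le_sq.2 (hx.trans (le_abs_self _))
      have hy2 : y ^ 2 ≤ (r + P) ^ 2 := sq_le_sq.2 (hy.trans (le_abs_self _))
      have hs0 : 0 ≤ x ^ 2 + x * y + y ^ 2 := by nlinarith [sq_nonneg (x + y)]
      have hs : x ^ 2 + x * y + y ^ 2 ≤ 3 * (r + P) ^ 2 := by nlinarith [sq_nonneg (x - y)]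
      have e : ε ^ 2 * ((lam ^ 2 - ε * a) * x - b * x ^ 3)
          - ε ^ 2 * ((lam ^ 2 - ε * a) * y - b * y ^ 3)
          = ε ^ 2 * (lam ^ 2 - ε * a - b * (x ^ 2 + x * y + y ^ 2)) * (x - y) := by ring
      have h1 : 0 ≤ lam ^ 2 - ε * a - b * (x ^ 2 + x * y + y ^ 2) := by nlinarith
      rw [e, abs_mul, abs_of_nonneg (by positivity)]
      exact mul_le_mul_of_nonneg_right (mul_le_mul_of_nonneg_left
        (by linarith [mul_nonneg hb.le hs0]) (by positivity)) (abs_nonneg _))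
    (by
      have : (lam ^ 2 - ε * a) * (r + P) ≤ lam ^ 2 * r := by nlinarith
      calc _ = ε ^ 2 * ((lam ^ 2 - ε * a) * (r + P)) := by ring
        _ ≤ ε ^ 2 * (lam ^ 2 * r) := by gcongr
        _ = _ := by ring)
  have hu : ∀ t, |w t + p₂ t| ≤ ε * C₁ := fun t =>
    ((abs_add_le _ _).trans (add_le_add (hw t) (by rw [hP]; exact hb₂ t))).trans hR
  have hzε : ∀ t, |z t / ε| ≤ lam * (ε * C₁) := fun t => by
    rw [abs_div, abs_of_pos hε, div_le_iff₀ hε]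
    refine (hz t).trans ?_
    rw [div_le_iff₀ (by positivity)]
    calc _ ≤ ε ^ 2 * lam ^ 2 * (ε * C₁) := by gcongr; linarith
      _ = _ := by ring
  refine ⟨fun t => (w t + p₂ t, z t / ε + p₁ t - lam * (w t + p₂ t)), fun t => ?_, fun t => ?_,
    hu, fun t => ?_⟩
  · rw [hF]
    have hud := (hwd t).add (hd₂ t)
    have hvd := (((hzd t).div_const ε).add (hd₁ t)).sub (hud.const_mul lam)
    refine (hud.prodMk hvd).congr_deriv ?_
    ext
    · field_simp
      ring
    · field_simp
      ring
  · simp only [hwT t, hzT t, hT₁ t, hT₂ t]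
  · have h1 : |lam * (w t + p₂ t)| ≤ lam * (ε * C₁) := by
      rw [abs_mul, abs_of_pos hlam]
      gcongr
      exact hu t
    calc _ ≤ |z t / ε| + |p₁ t| + |lam * (w t + p₂ t)| :=
        (abs_sub _ _).trans (add_le_add_left (abs_add_le _ _) _)
      _ ≤ lam * (ε * C₁) + ε * (γ * (lam + ω) / ω ^ 2) + lam * (ε * C₁) :=
        add_le_add (add_le_add (hzε t) (hb₁ t)) h1
      _ = _ := by ring

/-- **Example 1, conclusion.**
For the Duffing-type system `ẋ₁ = ε x₂`, `ẋ₂ = -ε c x₂ - ε² a x₁ - ε b x₁³ +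
ε γ cos ωt` (equivalent to `ü + εcu̇ + ε³au + ε²bu³ = ε²γ cos ωt` via
`x = (u, u̇/ε)`), with `a, b, c, γ > 0`, there exists `ε₀ > 0` such that for
every `ε ∈ (0, ε₀]` the system has at least one asymptotically stable
`2π/ω`-periodic solution `x_ε` with `x_ε → 0` uniformly as `ε → 0`. -/
theorem duffing_stable_periodic_solution
    (a b c γ ω : ℝ) (ha : 0 < a) (hb : 0 < b) (hc : 0 < c) (hγ : 0 < γ)
    (hω : 0 < ω)
    (F : ℝ → ℝ → ℝ × ℝ → ℝ × ℝ)
    (hF : ∀ ε t x, F ε t x =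
      (ε * x.2, -ε * c * x.2 - ε ^ 2 * a * x.1 - ε * b * x.1 ^ 3
        + ε * γ * Real.cos (ω * t))) :
    ∃ ε₀ > 0, ∃ X : ℝ → ℝ → ℝ × ℝ,
      (∀ ε ∈ Ioc (0:ℝ) ε₀,
        IsSolution (F ε) (X ε) ∧
        Periodic (X ε) (2 * Real.pi / ω) ∧
        IsAsympStable (F ε) (X ε)) ∧
      TendstoUniformly X (fun _ => 0) (nhdsWithin 0 (Ioi 0)) := by
  obtain ⟨C₁, hC₁⟩ : ∃ C₁, C₁ = 2 * γ * (c / 2) ^ 2 / (a * ω ^ 2) + 2 * γ / ω ^ 2 := ⟨_, rfl⟩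
  obtain ⟨C₂, hC₂⟩ : ∃ C₂, C₂ = 2 * (c / 2) * C₁ + γ * (c / 2 + ω) / ω ^ 2 := ⟨_, rfl⟩
  have hC₁pos : 0 < C₁ := by rw [hC₁]; positivity
  have hC₂pos : 0 < C₂ := by rw [hC₂]; positivity
  have hA : 0 < a + 12 * b * C₁ ^ 2 := by positivity
  obtain ⟨ε₀, hε₀, hε₀₁, hε₀s⟩ :
      ∃ ε₀ : ℝ, 0 < ε₀ ∧ ε₀ ≤ 1 ∧ ε₀ * (a + 12 * b * C₁ ^ 2) ≤ c ^ 2 / 4 :=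
    ⟨min 1 (c ^ 2 / 4 / (a + 12 * b * C₁ ^ 2)), lt_min one_pos (by positivity), min_le_left _ _,
      (le_div_iff₀ hA).1 (min_le_right _ _)⟩
  have key : ∀ ε ∈ Ioc (0 : ℝ) ε₀, ∃ x : ℝ → ℝ × ℝ, IsSolution (F ε) x ∧
      Periodic x (2 * Real.pi / ω) ∧ IsAsympStable (F ε) x ∧ ∀ t, ‖x t‖ ≤ ε * (C₁ + C₂) := by
    rintro ε ⟨hε, hε'⟩
    have hε₁ : ε ≤ 1 := hε'.trans hε₀₁
    have hsmall : ε * a + 12 * b * (ε * C₁) ^ 2 ≤ c ^ 2 / 4 := by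
      have h1 : ε * (a + 12 * b * C₁ ^ 2) ≤ c ^ 2 / 4 := le_trans (by gcongr) hε₀s
      have h2 : ε ^ 2 ≤ ε := by nlinarith
      have h3 : 12 * b * C₁ ^ 2 * ε ^ 2 ≤ 12 * b * C₁ ^ 2 * ε := by gcongr
      calc _ = ε * a + 12 * b * C₁ ^ 2 * ε ^ 2 := by ring
        _ ≤ c ^ 2 / 4 := by linarith
    obtain ⟨x, hx, hxT, hx₁, hx₂⟩ := exists_duffing_periodic (F := F ε) ha hb (half_pos hc) hγ hω
      hε hε₁ hC₁
      (by
        have : 0 ≤ b * (ε * C₁) ^ 2 := by positivity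
        linarith [div_pow c 2 2])
      (fun t x => by rw [hF, mul_div_cancel₀ c two_ne_zero])
    rw [← hC₂] at hx₂
    refine ⟨x, hx, hxT, duffing_isAsympStable ha hb hc hε (mul_pos hε hC₁pos) hsmall (hF ε) hx hx₁,
      fun t => max_le ((hx₁ t).trans ?_) ((hx₂ t).trans ?_)⟩ <;> gcongr <;> linarith
  choose! X hX using key
  refine ⟨ε₀, hε₀, X, fun ε hε => ⟨(hX ε hε).1, (hX ε hε).2.1, (hX ε hε).2.2.1⟩, ?_⟩
  rw [Metric.tendstoUniformly_iff]
  intro e he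
  have hC : 0 < C₁ + C₂ := by positivity
  filter_upwards [Ioo_mem_nhdsGT (lt_min hε₀ (div_pos he hC))] with ε hε t
  rw [dist_zero_left]
  refine ((hX ε ⟨hε.1, hε.2.le.trans (min_le_left _ _)⟩).2.2.2 t).trans_lt ?_
  exact (lt_div_iff₀ hC).1 (hε.2.trans_le (min_le_right _ _))
end

section
/- Consider the system ẋ₁ = x₂((1/4)(x₁² + x₂² − 2)^p + 1), ẋ₂ = −x₁((1/4)(x₁² + x₂² − 2)^p + 1) − ε² x₂ + ε sin t, with p ∈ ℕ. There exists ε₀ > 0 such that for every ε ∈ (0, ε₀] this system has at least one asymptotically stable 2π-periodic solution x_ε whose initial condition x_ε(0) converges, as ε → 0, to the circle {x ∈ ℝ² : x₁² + x₂² = 2} (the image of the generating cycle x₀(t) = (√2 sin t, √2 cos t)). -/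
open Set Filter Function MeasureTheory intervalIntegral

section LinearEstimates

variable {E : Type*} [NormedAddCommGroup E] [NormedSpace ℝ E]

/-- A version of the Picard-Lindelöf theorem which records that the solution stays in the ball. -/
theorem exists_solution_Icc [CompleteSpace E] {f : ℝ → E → E} {T C K a : ℝ} {x₀ : E}
    (hT : 0 ≤ T) (hC : 0 ≤ C) (hK : 0 ≤ K) (ha : 0 ≤ a)
    (hlip : ∀ t ∈ Icc 0 T, ∀ x ∈ Metric.closedBall x₀ a, ∀ y ∈ Metric.closedBall x₀ a,
      ‖f t x - f t y‖ ≤ K * ‖x - y‖)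
    (hcont : ∀ x ∈ Metric.closedBall x₀ a, ContinuousOn (fun t => f t x) (Icc 0 T))
    (hbound : ∀ t ∈ Icc 0 T, ∀ x ∈ Metric.closedBall x₀ a, ‖f t x‖ ≤ C)
    (hCT : C * T ≤ a) :
    ∃ α : ℝ → E, α 0 = x₀ ∧
      (∀ t ∈ Icc 0 T, HasDerivWithinAt α (f t (α t)) (Icc 0 T) t) ∧
      ∀ t ∈ Icc 0 T, ‖α t - x₀‖ ≤ a := by
  lift C to NNReal using hC
  lift K to NNReal using hK
  lift a to NNReal using ha
  have hf : IsPicardLindelof f (tmin := 0) (tmax := T) ⟨0, le_rfl, hT⟩ x₀ a 0 C K :=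
    { lipschitzOnWith := fun t ht => LipschitzOnWith.of_dist_le_mul fun x hx y hy => by
        simpa only [dist_eq_norm] using hlip t ht x hx y hy
      continuousOn := hcont
      norm_le := hbound
      mul_max_le := by simpa [hT] using hCT }
  have hx : x₀ ∈ Metric.closedBall x₀ ((0 : NNReal) : ℝ) := Metric.mem_closedBall_self le_rfl
  obtain ⟨α, hα⟩ := ODE.FunSpace.exists_isFixedPt_next hf hx
  refine ⟨α.compProj, ?_, fun t ht ↦ ?_, fun t ht => ?_⟩
  · have h := α.compProj_val (t := ⟨0, le_rfl, hT⟩)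
    rw [← hα, ODE.FunSpace.next_apply₀] at h
    rwa [hα] at h
  · apply ODE.hasDerivWithinAt_picard_Icc (t₀ := 0) ⟨le_rfl, hT⟩ hf.continuousOn_uncurry
      α.continuous_compProj.continuousOn (fun _ ht' ↦ α.compProj_mem_closedBall hf.mul_max_le)
      x₀ ht |>.congr_of_mem _ ht
    intro t' ht'
    nth_rw 1 [← hα]
    rw [ODE.FunSpace.compProj_of_mem ht', ODE.FunSpace.next_apply]
  · exact mem_closedBall_iff_norm.1 (α.compProj_mem_closedBall hf.mul_max_le)

theorem hasDerivWithinAt_Ici_of_Icc {w : ℝ → E} {v : E} {a b t : ℝ}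
    (h : HasDerivWithinAt w v (Icc a b) t) (ht : t ∈ Ico a b) :
    HasDerivWithinAt w v (Ici t) t :=
  h.mono_of_mem_nhdsWithin (Icc_mem_nhdsGE_of_mem ht)

theorem exp_half_le_two : Real.exp (1 / 2) ≤ 2 := by
  have h1 := Real.exp_one_lt_d9
  have h2 : Real.exp (1 / 2) * Real.exp (1 / 2) = Real.exp 1 := by
    rw [← Real.exp_add]; norm_num
  nlinarith [Real.exp_pos (1 / 2)]

theorem norm_le_two_mul_of_norm_deriv_le {w w' : ℝ → E} {k T : ℝ} (hk : 0 ≤ k)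
    (hw : ∀ t ∈ Icc 0 T, HasDerivWithinAt w (w' t) (Icc 0 T) t)
    (hb : ∀ t ∈ Icc 0 T, ‖w' t‖ ≤ k * ‖w t‖) (hsmall : k * T ≤ 1 / 2) :
    ∀ t ∈ Icc 0 T, ‖w t‖ ≤ 2 * ‖w 0‖ := by
  intro t ht
  have h := norm_le_gronwallBound_of_norm_deriv_right_le (f := w) (f' := w') (δ := ‖w 0‖)
    (K := k) (ε := 0) (a := 0) (b := T) (fun t ht => (hw t ht).continuousWithinAt)
    (fun t ht => hasDerivWithinAt_Ici_of_Icc (hw t (Ico_subset_Icc_self ht)) ht) le_rfl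
    (fun t ht => by simpa using hb t (Ico_subset_Icc_self ht)) t ht
  rw [gronwallBound_ε0, sub_zero] at h
  have h2 : Real.exp (k * t) ≤ 2 :=
    (Real.exp_le_exp.2 ((mul_le_mul_of_nonneg_left ht.2 hk).trans hsmall)).trans exp_half_le_two
  nlinarith [norm_nonneg (w 0)]

/-- First order expansion of the time-`T` map of an almost linear equation with a small factor. -/
theorem norm_sub_sub_le_of_near_linear {w w' : ℝ → E} {B Ψ : ℝ → E →L[ℝ] E} {κ c C T : ℝ}
    (hκ : 0 ≤ κ) (hc : 0 ≤ c) (hT : 0 ≤ T) (hC : 0 ≤ C)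
    (hw : ∀ t ∈ Icc 0 T, HasDerivWithinAt w (w' t) (Icc 0 T) t)
    (hΨ : ∀ t, HasDerivAt Ψ (B t) t) (hΨ0 : Ψ 0 = 0)
    (hB : ∀ t ∈ Icc 0 T, ‖B t‖ ≤ C)
    (hww : ∀ t ∈ Icc 0 T, ‖w' t - κ • B t (w t)‖ ≤ κ * c * ‖w t‖)
    (hsmall : κ * (C + c) * T ≤ 1 / 2) :
    ‖w T - w 0 - κ • Ψ T (w 0)‖ ≤ κ * T * (2 * c + 2 * κ * C * (C + c) * T) * ‖w 0‖ := by
  have hBw : ∀ t ∈ Icc 0 T, ∀ v, ‖κ • B t v‖ ≤ κ * C * ‖v‖ := fun t ht v => by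
    rw [norm_smul, Real.norm_of_nonneg hκ, mul_assoc]
    exact mul_le_mul_of_nonneg_left (((B t).le_opNorm v).trans
      (mul_le_mul_of_nonneg_right (hB t ht) (norm_nonneg _))) hκ
  have hd : ∀ t ∈ Icc 0 T, ‖w' t‖ ≤ κ * (C + c) * ‖w t‖ := fun t ht => by
    have h1 := norm_add_le (w' t - κ • B t (w t)) (κ • B t (w t))
    rw [sub_add_cancel] at h1
    have h2 := hww t ht
    have h3 := hBw t ht (w t)
    nlinarith
  have hk : 0 ≤ κ * (C + c) := by positivity
  have h2 := norm_le_two_mul_of_norm_deriv_le hk hw hd hsmall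
  have h3 : ∀ t ∈ Icc 0 T, ‖w t - w 0‖ ≤ κ * (C + c) * (2 * ‖w 0‖) * T := fun t ht => by
    refine (norm_image_sub_le_of_norm_deriv_le_segment' hw (fun s hs =>
      (hd s (Ico_subset_Icc_self hs)).trans (mul_le_mul_of_nonneg_left
        (h2 s (Ico_subset_Icc_self hs)) hk)) t ht).trans ?_
    rw [sub_zero]
    exact mul_le_mul_of_nonneg_left ht.2 (by positivity)
  have hder : ∀ t ∈ Icc 0 T, HasDerivWithinAt (fun t => w t - κ • Ψ t (w 0))
      (w' t - κ • B t (w 0)) (Icc 0 T) t := fun t ht =>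
    (hw t ht).sub ((((hΨ t).clm_apply (hasDerivAt_const t (w 0))).hasDerivWithinAt.const_smul κ
      ).congr_deriv (by simp))
  have h4 := norm_image_sub_le_of_norm_deriv_le_segment' hder
    (C := κ * (2 * c + 2 * κ * C * (C + c) * T) * ‖w 0‖) (fun t ht => by
      have ht := Ico_subset_Icc_self ht
      have e : w' t - κ • B t (w 0) = (w' t - κ • B t (w t)) + κ • B t (w t - w 0) := by
        rw [map_sub, smul_sub]; abel
      rw [e]
      refine (norm_add_le _ _).trans ?_
      have a1 := hww t ht
      have a2 := hBw t ht (w t - w 0)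
      have a3 := mul_le_mul_of_nonneg_left (h2 t ht) (mul_nonneg hκ hc)
      have a4 := mul_le_mul_of_nonneg_left (h3 t ht) (mul_nonneg hκ hC)
      nlinarith) T ⟨hT, le_rfl⟩
  simp only [hΨ0, _root_.zero_apply, smul_zero, sub_zero] at h4
  have e : w T - w 0 - κ • Ψ T (w 0) = w T - κ • Ψ T (w 0) - w 0 := by abel
  rw [e]
  refine h4.trans (le_of_eq ?_)
  ring

end LinearEstimates

section Stability

variable {φ : ℝ → ℝ × ℝ → ℝ × ℝ} {Dφ : ℝ → ℝ × ℝ → (ℝ × ℝ) →L[ℝ] ℝ × ℝ}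
  {x : ℝ → ℝ × ℝ} {M : (ℝ × ℝ) →L[ℝ] ℝ × ℝ} {T : ℝ}

theorem IsSolution.continuous (hx : IsSolution φ x) : Continuous x :=
  continuous_iff_continuousAt.2 fun t => (hx t).continuousAt

theorem IsSolution.comp_add (hφ : ∀ t v, φ (t + T) v = φ t v) (hx : IsSolution φ x) :
    IsSolution φ (fun t => x (t + T)) := fun t => by
  have h := (hx (t + T)).comp_add_const t T
  rwa [hφ] at h

/-- Uniform differentiability of the vector field along a solution. -/
theorem exists_uniform_linearization (hD : ∀ t v, HasFDerivAt (φ t) (Dφ t v) v)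
    (hDc : Continuous (uncurry Dφ)) (hx : Continuous x) (S : ℝ) {c : ℝ} (hc : 0 < c) :
    ∃ ρ > 0, ∀ t ∈ Icc 0 S, ∀ v : ℝ × ℝ, ‖v‖ ≤ ρ →
      ‖φ t (x t + v) - φ t (x t) - Dφ t (x t) v‖ ≤ c * ‖v‖ := by
  have h : ∀ᶠ v in nhds (0 : ℝ × ℝ), ∀ t ∈ Icc 0 S, ‖Dφ t (x t + v) - Dφ t (x t)‖ < c := by
    apply isCompact_Icc.eventually_forall_of_forall_eventually
    intro t _
    have hcont : Continuous fun z : (ℝ × ℝ) × ℝ =>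
        ‖Dφ z.2 (x z.2 + z.1) - Dφ z.2 (x z.2)‖ :=
      ((hDc.comp (by fun_prop : Continuous fun z : (ℝ × ℝ) × ℝ => (z.2, x z.2 + z.1))).sub
        (hDc.comp (by fun_prop : Continuous fun z : (ℝ × ℝ) × ℝ => (z.2, x z.2)))).norm
    exact hcont.continuousAt.eventually_lt continuousAt_const (by simpa using hc)
  obtain ⟨ρ, hρ, hball⟩ := Metric.eventually_nhds_iff_ball.1 h
  refine ⟨ρ / 2, by positivity, fun t ht v hv => ?_⟩
  have := (convex_ball (x t) ρ).norm_image_sub_le_of_norm_hasFDerivWithin_le' (f := φ t)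
    (f' := Dφ t) (φ := Dφ t (x t)) (C := c) (x := x t) (y := x t + v)
    (fun y _ => (hD t y).hasFDerivWithinAt) (fun y hy => by
      have := hball (y - x t) (by simpa [dist_eq_norm] using hy) t ht
      simpa using this.le) (Metric.mem_ball_self hρ) (by
      rw [mem_ball_iff_norm, add_sub_cancel_left]; linarith)
  simpa using this

theorem exists_norm_Dφ_le (hDc : Continuous (uncurry Dφ)) (hx : Continuous x) (S : ℝ) :
    ∃ C > 0, ∀ t ∈ Icc 0 S, ‖Dφ t (x t)‖ ≤ C := by
  have hcont : Continuous fun t => Dφ t (x t) :=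
    hDc.comp (by fun_prop : Continuous fun t => (t, x t))
  obtain ⟨C, hC⟩ := isCompact_Icc.exists_bound_of_continuousOn
    (s := Icc (0 : ℝ) S) hcont.continuousOn
  exact ⟨max C 1, by positivity, fun t ht => (hC t ht).trans (le_max_left _ _)⟩

/-- Nearby solutions separate at most by a bounded factor over a bounded time interval. -/
theorem exists_growth_bound (hD : ∀ t v, HasFDerivAt (φ t) (Dφ t v) v)
    (hDc : Continuous (uncurry Dφ)) (hx : IsSolution φ x) (S : ℝ) :
    ∃ K > 0, ∃ ρ > 0, ∀ y, IsSolution φ y → ‖y 0 - x 0‖ ≤ ρ →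
      ∀ t ∈ Icc 0 S, ‖y t - x t‖ ≤ K * ‖y 0 - x 0‖ := by
  obtain ⟨C, hC, hCb⟩ := exists_norm_Dφ_le hDc hx.continuous S
  obtain ⟨ρ, hρ, hlin⟩ := exists_uniform_linearization hD hDc hx.continuous S one_pos
  have hK : 0 < Real.exp ((C + 2) * S) := Real.exp_pos _
  set K := Real.exp ((C + 2) * S) with hKdef
  have key : ∀ y, IsSolution φ y → ∀ δ > 0, ‖y 0 - x 0‖ ≤ δ → K * δ ≤ ρ →
      ∀ t ∈ Icc 0 S, ‖y t - x t‖ ≤ K * δ := by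
    intro y hy δ hδ hyδ hKδ
    have hle : ∀ t ∈ Icc 0 S, δ * Real.exp ((C + 2) * t) ≤ K * δ := fun t ht => by
      rw [mul_comm]
      exact mul_le_mul_of_nonneg_right
        (Real.exp_le_exp.2 (mul_le_mul_of_nonneg_left ht.2 (by positivity))) hδ.le
    intro t ht
    refine le_trans ?_ (hle t ht)
    refine image_norm_le_of_norm_deriv_right_lt_deriv_boundary (a := 0) (b := S)
      (f := fun t => y t - x t) (f' := fun t => φ t (y t) - φ t (x t))
      (B := fun t => δ * Real.exp ((C + 2) * t))
      (B' := fun t => δ * (Real.exp ((C + 2) * t) * (C + 2)))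
      (hy.continuous.sub hx.continuous).continuousOn
      (fun t _ => ((hy t).sub (hx t)).hasDerivWithinAt) (by simpa using hyδ)
      (fun t => ?_) (fun t ht he => ?_) ht
    · have := ((hasDerivAt_id t).const_mul (C + 2)).exp.const_mul δ
      simpa using this
    · have ht := Ico_subset_Icc_self ht
      have h1 := hlin t ht (y t - x t) (by rw [he]; exact (hle t ht).trans hKδ)
      have h2 := ((Dφ t (x t)).le_opNorm (y t - x t)).trans
        (mul_le_mul_of_nonneg_right (hCb t ht) (norm_nonneg _))
      have h3 := norm_add_le (φ t (x t + (y t - x t)) - φ t (x t) - Dφ t (x t) (y t - x t))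
        (Dφ t (x t) (y t - x t))
      rw [sub_add_cancel, add_sub_cancel] at h3
      have h4 : 0 < δ * Real.exp ((C + 2) * t) := by positivity
      rw [add_sub_cancel] at h1
      simp only [he] at h1 h2
      calc _ ≤ _ := h3
        _ ≤ 1 * (δ * Real.exp ((C + 2) * t)) + C * (δ * Real.exp ((C + 2) * t)) :=
          add_le_add h1 h2
        _ < _ := by linarith
  refine ⟨K, hK, ρ / K, by positivity, fun y hy hyρ t ht => ?_⟩
  rcases (norm_nonneg (y 0 - x 0)).eq_or_lt with h0 | h0
  · rw [← h0, mul_zero]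
    refine le_of_forall_pos_le_add fun ε hε => ?_
    have := key y hy (min ρ ε / K) (by positivity) (by rw [← h0]; positivity)
      (by rw [mul_div_cancel₀ _ hK.ne']; exact min_le_left _ _) t ht
    rw [mul_div_cancel₀ _ hK.ne'] at this
    rw [zero_add]
    exact this.trans (min_le_right _ _)
  · exact key y hy _ h0 le_rfl (by rw [mul_comm]; exact (le_div_iff₀ hK).1 hyρ) t ht

/-- The period map is differentiable at the initial value of `x`, and its derivative is the
time-`T` map of the linearized equation. -/
theorem exists_period_map_linearization (hT : 0 < T) (hD : ∀ t v, HasFDerivAt (φ t) (Dφ t v) v)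
    (hDc : Continuous (uncurry Dφ)) (hx : IsSolution φ x)
    (hM : ∀ v, ∃ z : ℝ → ℝ × ℝ, z 0 = v ∧ z T = M v ∧
      ∀ t ∈ Icc 0 T, HasDerivWithinAt z (Dφ t (x t) (z t)) (Icc 0 T) t) {c : ℝ} (hc : 0 < c) :
    ∃ ρ > 0, ∀ y, IsSolution φ y → ‖y 0 - x 0‖ ≤ ρ →
      ‖y T - x T - M (y 0 - x 0)‖ ≤ c * ‖y 0 - x 0‖ := by
  obtain ⟨C, hC, hCb⟩ := exists_norm_Dφ_le hDc hx.continuous T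
  obtain ⟨K, hK, ρ₁, hρ₁, hgr⟩ := exists_growth_bound hD hDc hx T
  set c' := c * C / (K * Real.exp (C * T)) with hc'
  have hc'0 : 0 < c' := by positivity
  obtain ⟨ρ₂, hρ₂, hlin⟩ := exists_uniform_linearization hD hDc hx.continuous T hc'0
  refine ⟨min ρ₁ (ρ₂ / K), by positivity, fun y hy hyρ => ?_⟩
  obtain ⟨z, hz0, hzT, hz⟩ := hM (y 0 - x 0)
  have hw := hgr y hy (hyρ.trans (min_le_left _ _))
  have hder : ∀ t ∈ Icc 0 T, HasDerivWithinAt (fun t => y t - x t - z t)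
      (φ t (y t) - φ t (x t) - Dφ t (x t) (z t)) (Icc 0 T) t := fun t ht =>
    ((hy t).sub (hx t)).hasDerivWithinAt.sub (hz t ht)
  have h := norm_le_gronwallBound_of_norm_deriv_right_le (δ := 0)
    (K := C) (ε := c' * (K * ‖y 0 - x 0‖)) (a := 0) (b := T)
    (fun t ht => (hder t ht).continuousWithinAt)
    (fun t ht => hasDerivWithinAt_Ici_of_Icc (hder t (Ico_subset_Icc_self ht)) ht) (by simp [hz0])
    (fun t ht => by
      have ht := Ico_subset_Icc_self ht
      have h0 := hw t ht
      have h1 := hlin t ht (y t - x t) (h0.trans (by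
        rw [mul_comm]
        exact (le_div_iff₀ hK).1 (hyρ.trans (min_le_right _ _))))
      have h2 := ((Dφ t (x t)).le_opNorm (y t - x t - z t)).trans
        (mul_le_mul_of_nonneg_right (hCb t ht) (norm_nonneg _))
      have h3 := norm_add_le (Dφ t (x t) (y t - x t - z t))
        (φ t (x t + (y t - x t)) - φ t (x t) - Dφ t (x t) (y t - x t))
      rw [add_sub_cancel, map_sub (Dφ t (x t)) (y t - x t)] at h3
      rw [map_sub (Dφ t (x t)) (y t - x t)] at h2
      have e : φ t (y t) - φ t (x t) - Dφ t (x t) (z t) = Dφ t (x t) (y t - x t)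
        - Dφ t (x t) (z t) + (φ t (y t) - φ t (x t) - Dφ t (x t) (y t - x t)) := by abel
      rw [e]
      rw [add_sub_cancel] at h1
      exact h3.trans (add_le_add h2 (h1.trans (mul_le_mul_of_nonneg_left h0 hc'0.le))))
    T ⟨hT.le, le_rfl⟩
  rw [gronwallBound_of_K_ne_0 hC.ne'] at h
  simp only [zero_mul, zero_add, sub_zero, hzT] at h
  refine h.trans ?_
  have hexp := Real.exp_pos (C * T)
  have e : c' * (K * ‖y 0 - x 0‖) / C * (Real.exp (C * T) - 1) =
      c * ‖y 0 - x 0‖ * ((Real.exp (C * T) - 1) / Real.exp (C * T)) := by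
    rw [hc']; field_simp
  rw [e]
  refine mul_le_of_le_one_right (by positivity) ?_
  rw [div_le_one hexp]; linarith

theorem exists_iterate_linearization (hT : 0 < T) (hφ : ∀ t v, φ (t + T) v = φ t v)
    (hD : ∀ t v, HasFDerivAt (φ t) (Dφ t v) v)
    (hDc : Continuous (uncurry Dφ)) (hx : IsSolution φ x) (hxT : Periodic x T)
    (hM : ∀ v, ∃ z : ℝ → ℝ × ℝ, z 0 = v ∧ z T = M v ∧
      ∀ t ∈ Icc 0 T, HasDerivWithinAt z (Dφ t (x t) (z t)) (Icc 0 T) t) (n : ℕ) :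
    ∀ c > 0, ∃ ρ > 0, ∀ y, IsSolution φ y → ‖y 0 - x 0‖ ≤ ρ →
      ‖y (n * T) - x 0 - (M ^ n) (y 0 - x 0)‖ ≤ c * ‖y 0 - x 0‖ := by
  have hφn : ∀ n : ℕ, ∀ t v, φ (t + n * T) v = φ t v := fun n t v =>
    Periodic.nat_mul (f := fun t => φ t v) (fun t => hφ t v) n t
  induction n with
  | zero => exact fun c hc => ⟨1, one_pos, fun y _ _ => by simp; positivity⟩
  | succ n ih =>
    intro c hc
    obtain ⟨ρ₁, hρ₁, h₁⟩ := ih (min 1 (c / (2 * (‖M‖ + 1)))) (by positivity)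
    obtain ⟨ρ₂, hρ₂, h₂⟩ := exists_period_map_linearization hT hD hDc hx hM
      (c := c / (2 * (‖M ^ n‖ + 1))) (by positivity)
    refine ⟨min ρ₁ (ρ₂ / (‖M ^ n‖ + 1)), by positivity, fun y hy hyρ => ?_⟩
    have a₁ := h₁ y hy (hyρ.trans (min_le_left _ _))
    set w := y 0 - x 0
    have b₁ : ‖y (n * T) - x 0‖ ≤ (‖M ^ n‖ + 1) * ‖w‖ := by
      have e := norm_add_le (y (n * T) - x 0 - (M ^ n) w) ((M ^ n) w)
      rw [sub_add_cancel] at e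
      have e2 := (M ^ n).le_opNorm w
      have e3 := a₁.trans (mul_le_mul_of_nonneg_right (min_le_left _ _) (norm_nonneg w))
      linarith
    have a₂ := h₂ (fun t => y (t + n * T)) (hy.comp_add (hφn n)) (by
      have := (le_div_iff₀ (by positivity)).1 (hyρ.trans (min_le_right _ _))
      simp only [zero_add]
      linarith)
    have hxT' : x T = x 0 := by simpa using hxT 0
    simp only [zero_add, hxT'] at a₂
    have eT : ((n + 1 : ℕ) : ℝ) * T = T + n * T := by push_cast; ring
    have e : y (T + n * T) - x 0 - (M ^ (n + 1)) w =
        (y (T + n * T) - x 0 - M (y (n * T) - x 0)) + M (y (n * T) - x 0 - (M ^ n) w) := by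
      rw [map_sub M _ ((M ^ n) w), pow_succ']
      simp
    rw [eT, e]
    have hMn : 0 < ‖M ^ n‖ + 1 := by positivity
    have hMp : 0 < ‖M‖ + 1 := by positivity
    calc _ ≤ _ := norm_add_le _ _
      _ ≤ c / (2 * (‖M ^ n‖ + 1)) * ((‖M ^ n‖ + 1) * ‖w‖) +
          (‖M‖ + 1) * (c / (2 * (‖M‖ + 1)) * ‖w‖) := by
        refine add_le_add (a₂.trans (by gcongr)) ((M.le_opNorm _).trans ?_)
        refine mul_le_mul (by linarith) (a₁.trans ?_) (norm_nonneg _) hMp.le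
        exact mul_le_mul_of_nonneg_right (min_le_right _ _) (norm_nonneg w)
      _ = c * ‖w‖ := by field_simp; ring

/-- A periodic solution is asymptotically stable if some power of the time-`T` map of the
linearized equation is a strong contraction. -/
theorem isAsympStable_of_pow_contracting (hT : 0 < T) (hφ : ∀ t v, φ (t + T) v = φ t v)
    (hD : ∀ t v, HasFDerivAt (φ t) (Dφ t v) v)
    (hDc : Continuous (uncurry Dφ)) (hx : IsSolution φ x) (hxT : Periodic x T)
    (hM : ∀ v, ∃ z : ℝ → ℝ × ℝ, z 0 = v ∧ z T = M v ∧
      ∀ t ∈ Icc 0 T, HasDerivWithinAt z (Dφ t (x t) (z t)) (Icc 0 T) t) {N : ℕ} (hN : 0 < N)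
    (hMN : ∀ v, ‖(M ^ N) v‖ ≤ 1 / 4 * ‖v‖) :
    IsAsympStable φ x := by
  obtain ⟨ρ₁, hρ₁, h₁⟩ := exists_iterate_linearization hT hφ hD hDc hx hxT hM N (1 / 4)
    (by norm_num)
  obtain ⟨K, hK, ρ₂, hρ₂, h₂⟩ := exists_growth_bound hD hDc hx (N * T)
  set S := (N : ℝ) * T with hS
  have hSpos : 0 < S := by positivity
  have hφS : ∀ (n : ℕ) t v, φ (t + n * S) v = φ t v := fun n t v => by
    have := Periodic.nat_mul (f := fun t => φ t v) (fun t => hφ t v) (n * N) t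
    rw [hS, ← mul_assoc]; exact_mod_cast this
  have hxS : ∀ (n : ℕ) t, x (t + n * S) = x t := fun n t => by
    have := hxT.nat_mul (n * N) t
    rw [hS, ← mul_assoc]; exact_mod_cast this
  set ρ := min ρ₁ ρ₂ with hρdef
  have hρ : 0 < ρ := by positivity
  have step : ∀ y, IsSolution φ y → ‖y 0 - x 0‖ ≤ ρ → ‖y S - x 0‖ ≤ 1 / 2 * ‖y 0 - x 0‖ := by
    intro y hy hyρ
    have a := h₁ y hy (hyρ.trans (min_le_left _ _))
    have e := norm_add_le (y S - x 0 - (M ^ N) (y 0 - x 0)) ((M ^ N) (y 0 - x 0))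
    rw [sub_add_cancel] at e
    have := hMN (y 0 - x 0)
    linarith
  have iter : ∀ y, IsSolution φ y → ‖y 0 - x 0‖ ≤ ρ → ∀ n : ℕ,
      ‖y (n * S) - x 0‖ ≤ (1 / 2) ^ n * ‖y 0 - x 0‖ := by
    intro y hy hyρ n
    induction n with
    | zero => simp
    | succ n ih =>
      have hle : ((1 : ℝ) / 2) ^ n ≤ 1 := pow_le_one₀ (by norm_num) (by norm_num)
      have a := step (fun t => y (t + n * S)) (hy.comp_add (hφS n)) (by
        simp only [zero_add]
        exact (ih.trans (mul_le_of_le_one_left (norm_nonneg _) hle)).trans hyρ)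
      simp only [zero_add] at a
      have eT : ((n + 1 : ℕ) : ℝ) * S = S + n * S := by push_cast; ring
      rw [eT, pow_succ]
      linarith
  have bound : ∀ y, IsSolution φ y → ‖y 0 - x 0‖ ≤ ρ → ∀ t ≥ 0,
      ‖y t - x t‖ ≤ K * ((1 / 2) ^ ⌊t / S⌋₊ * ‖y 0 - x 0‖) := by
    intro y hy hyρ t ht
    set n := ⌊t / S⌋₊
    have hle : ((1 : ℝ) / 2) ^ n ≤ 1 := pow_le_one₀ (by norm_num) (by norm_num)
    have hn1 : n * S ≤ t := (le_div_iff₀ hSpos).1 (Nat.floor_le (by positivity))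
    have hn2 : t < (n + 1) * S := (div_lt_iff₀ hSpos).1 (Nat.lt_floor_add_one _)
    have hi := iter y hy hyρ n
    have a := h₂ (fun t => y (t + n * S)) (hy.comp_add (hφS n)) (by
        simp only [zero_add]
        exact ((hi.trans (mul_le_of_le_one_left (norm_nonneg _) hle)).trans hyρ).trans
          (min_le_right _ _)) (t - n * S) ⟨by linarith, by linarith⟩
    have hxt := hxS n (t - n * S)
    rw [sub_add_cancel] at hxt
    simp only [zero_add, sub_add_cancel, ← hxt] at a
    exact a.trans (mul_le_mul_of_nonneg_left hi hK.le)
  constructor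
  · intro η hη
    refine ⟨min ρ (η / (2 * K)), by positivity, fun y hy hyδ t ht => ?_⟩
    have hb := bound y hy (hyδ.le.trans (min_le_left _ _)) t ht
    have h3 := (lt_div_iff₀ (by positivity)).1 (hyδ.trans_le (min_le_right _ _))
    have hle : ((1 : ℝ) / 2) ^ ⌊t / S⌋₊ ≤ 1 := pow_le_one₀ (by norm_num) (by norm_num)
    have h4 := mul_le_mul_of_nonneg_left
      (mul_le_of_le_one_left (norm_nonneg (y 0 - x 0)) hle) hK.le
    have h5 := mul_nonneg hK.le (norm_nonneg (y 0 - x 0))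
    linarith
  · refine ⟨ρ, hρ, fun y hy hyδ => ?_⟩
    have hlim : Tendsto (fun t : ℝ => K * ((1 / 2 : ℝ) ^ ⌊t / S⌋₊ * ‖y 0 - x 0‖)) atTop
        (nhds (K * (0 * ‖y 0 - x 0‖))) :=
      (((tendsto_pow_atTop_nhds_zero_of_lt_one (by norm_num) (by norm_num)).comp
        (tendsto_nat_floor_atTop.comp (tendsto_id.atTop_div_const hSpos))).mul_const _).const_mul _
    rw [zero_mul, mul_zero] at hlim
    refine squeeze_zero' (Eventually.of_forall fun t => norm_nonneg _) ?_ hlim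
    filter_upwards [eventually_ge_atTop 0] with t ht using bound y hy hyδ.le t ht

end Stability

section PlaneMaps

/-- Determinant of a linear map of the plane. -/
def planeDet (A : (ℝ × ℝ) →L[ℝ] ℝ × ℝ) : ℝ :=
  (A (1, 0)).1 * (A (0, 1)).2 - (A (0, 1)).1 * (A (1, 0)).2

/-- Trace of a linear map of the plane. -/
def planeTrace (A : (ℝ × ℝ) →L[ℝ] ℝ × ℝ) : ℝ := (A (1, 0)).1 + (A (0, 1)).2

variable {A L M : (ℝ × ℝ) →L[ℝ] ℝ × ℝ}

theorem plane_map_apply (A : (ℝ × ℝ) →L[ℝ] ℝ × ℝ) (v : ℝ × ℝ) :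
    A v = v.1 • A (1, 0) + v.2 • A (0, 1) := by
  rw [← map_smul, ← map_smul, ← map_add]
  simp

theorem plane_cayley_hamilton (A : (ℝ × ℝ) →L[ℝ] ℝ × ℝ) (v : ℝ × ℝ) :
    A (A v) = planeTrace A • A v - planeDet A • v := by
  rw [plane_map_apply A (A v), plane_map_apply A v]
  ext <;> simp [planeTrace, planeDet] <;> ring

theorem continuous_planeDet : Continuous planeDet := by
  unfold planeDet; fun_prop

theorem continuous_planeTrace : Continuous planeTrace := by
  unfold planeTrace; fun_prop

theorem surjective_of_planeDet_pos (h : 0 < planeDet A) : Function.Surjective A := by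
  intro y
  refine ⟨((planeDet A)⁻¹ * (y.1 * (A (0, 1)).2 - y.2 * (A (0, 1)).1),
    (planeDet A)⁻¹ * (y.2 * (A (1, 0)).1 - y.1 * (A (1, 0)).2)), ?_⟩
  rw [plane_map_apply]
  have h' := h.ne'
  ext <;> simp <;> field_simp <;> unfold planeDet <;> ring

theorem norm_root_lt_one {d τ : ℝ} (hd1 : d < 1) (hτ : |τ| < 1 + d) {l : ℂ}
    (hl : l * l - τ * l + d = 0) : ‖l‖ < 1 := by
  obtain ⟨x, y⟩ := l
  have hre := congrArg Complex.re hl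
  have him := congrArg Complex.im hl
  simp at hre him
  obtain ⟨h1, h2⟩ := abs_lt.1 hτ
  have hsq : x * x + y * y < 1 := by
    by_cases hy : y = 0
    · subst hy
      simp at hre
      have hx1 : x < 1 := by
        by_contra! hx
        nlinarith [mul_nonneg (sub_nonneg.2 hx) (sub_nonneg.2 (hd1.le.trans hx))]
      have hx2 : -1 < x := by
        by_contra! hx
        nlinarith [mul_nonneg (sub_nonneg.2 hx) (by linarith : 0 ≤ -d - x)]
      nlinarith
    · have hτx : τ = 2 * x := mul_right_cancel₀ hy (by linarith)
      subst hτx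
      nlinarith
  rw [← sq_lt_one_iff₀ (norm_nonneg _), ← Complex.normSq_eq_norm_sq, Complex.normSq_mk]
  exact hsq

theorem tendsto_zero_of_linear_recurrence {d τ : ℝ} (hd1 : d < 1) (hτ : |τ| < 1 + d) {c : ℕ → ℝ}
    (hc : ∀ n, c (n + 2) = τ * c (n + 1) - d * c n) : Tendsto c atTop (nhds 0) := by
  obtain ⟨s, hs⟩ := IsAlgClosed.exists_pow_nat_eq ((τ : ℂ) ^ 2 - 4 * d) (n := 2) (by norm_num)
  set l₁ : ℂ := (τ + s) / 2
  set l₂ : ℂ := (τ - s) / 2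
  have hsum : l₁ + l₂ = τ := by simp only [l₁, l₂]; ring
  have hprod : l₁ * l₂ = d := by
    simp only [l₁, l₂]; linear_combination (-1 / 4) * hs
  have h₁ : ‖l₁‖ < 1 := norm_root_lt_one hd1 hτ (by rw [← hsum, ← hprod]; ring)
  have h₂ : ‖l₂‖ < 1 := norm_root_lt_one hd1 hτ (by rw [← hsum, ← hprod]; ring)
  obtain ⟨r, hr, hr1⟩ := exists_between (max_lt h₁ h₂)
  have hr0 : 0 < r := (norm_nonneg _).trans_lt ((le_max_left _ _).trans_lt hr)
  have he : ∀ n, (c (n + 1) : ℂ) - l₁ * c n = l₂ ^ n * (c 1 - l₁ * c 0) := by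
    intro n
    induction n with
    | zero => simp
    | succ n ih =>
      rw [pow_succ', mul_assoc, ← ih, hc n]
      push_cast
      rw [← hsum, ← hprod]
      ring
  set e := ‖(c 1 : ℂ) - l₁ * c 0‖
  have hb : ∀ n, ‖(c n : ℂ)‖ ≤ r ^ n * ‖(c 0 : ℂ)‖ + n * r ^ n * (e / r) := by
    intro n
    induction n with
    | zero => simp
    | succ n ih =>
      have h := norm_add_le ((c (n + 1) : ℂ) - l₁ * c n) (l₁ * c n)
      rw [sub_add_cancel, he, norm_mul, norm_mul, norm_pow] at h
      have h3 : ‖l₂‖ ^ n * e ≤ r ^ n * e :=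
        mul_le_mul_of_nonneg_right
          (pow_le_pow_left₀ (norm_nonneg _) ((le_max_right _ _).trans hr.le) n) (norm_nonneg _)
      have h4 : ‖l₁‖ * ‖(c n : ℂ)‖ ≤ r * (r ^ n * ‖(c 0 : ℂ)‖ + n * r ^ n * (e / r)) :=
        mul_le_mul ((le_max_left _ _).trans hr.le) ih (norm_nonneg _) hr0.le
      refine h.trans ((add_le_add h3 h4).trans (le_of_eq ?_))
      push_cast
      field_simp
      ring
  have hlim : Tendsto (fun n : ℕ => r ^ n * ‖(c 0 : ℂ)‖ + n * r ^ n * (e / r)) atTop (nhds 0) := by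
    have := ((tendsto_pow_atTop_nhds_zero_of_lt_one hr0.le hr1).mul_const ‖(c 0 : ℂ)‖).add
      ((tendsto_self_mul_const_pow_of_lt_one hr0.le hr1).mul_const (e / r))
    simpa using this
  refine squeeze_zero_norm (fun n => ?_) hlim
  simpa using hb n

/-- The Jury criterion: powers of a plane map with multipliers inside the unit disc contract. -/
theorem exists_pow_contracting (hd1 : planeDet M < 1) (hτ : |planeTrace M| < 1 + planeDet M) :
    ∃ N : ℕ, 0 < N ∧ ∀ v, ‖(M ^ N) v‖ ≤ 1 / 4 * ‖v‖ := by
  have hrec : ∀ v n, (M ^ (n + 2)) v = planeTrace M • (M ^ (n + 1)) v - planeDet M • (M ^ n) v := by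
    intro v n
    have h := plane_cayley_hamilton M ((M ^ n) v)
    rw [pow_succ' M (n + 1), pow_succ' M n]
    simpa using h
  have hlim : ∀ v, Tendsto (fun n => (M ^ n) v) atTop (nhds (0, 0)) := fun v =>
    (tendsto_zero_of_linear_recurrence hd1 hτ (c := fun n => ((M ^ n) v).1) fun n => by
      simpa using congrArg Prod.fst (hrec v n)).prodMk_nhds
      (tendsto_zero_of_linear_recurrence hd1 hτ (c := fun n => ((M ^ n) v).2) fun n => by
        simpa using congrArg Prod.snd (hrec v n))
  have hev : ∀ v, ∀ᶠ n in atTop, ‖(M ^ n) v‖ < 1 / 8 := fun v => by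
    have := (hlim v).norm
    rw [Prod.mk_zero_zero, norm_zero] at this
    exact this.eventually_lt_const (by norm_num)
  obtain ⟨N, ⟨h1, h2⟩, hN⟩ := (((hev (1, 0)).and (hev (0, 1))).and (eventually_gt_atTop 0)).exists
  refine ⟨N, hN, fun v => ?_⟩
  rw [plane_map_apply]
  refine (norm_add_le _ _).trans ?_
  rw [norm_smul, norm_smul]
  have h3 := norm_fst_le v
  have h4 := norm_snd_le v
  have h5 := mul_le_mul h3 h1.le (norm_nonneg _) (norm_nonneg _)
  have h6 := mul_le_mul h4 h2.le (norm_nonneg _) (norm_nonneg _)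
  linarith

/-- Near-identity plane maps `1 + κ L + o(κ)` with `det L > 0` satisfy the trace inequality in
the Jury criterion. -/
theorem exists_abs_planeTrace_lt (hL : 0 < planeDet L) :
    ∃ c > 0, ∃ κ₀ > 0, ∀ κ ∈ Ioc 0 κ₀, ∀ M : (ℝ × ℝ) →L[ℝ] ℝ × ℝ, 0 < planeDet M →
      (∀ v, ‖M v - v - κ • L v‖ ≤ κ * c * ‖v‖) → |planeTrace M| < 1 + planeDet M := by
  have h1 : ∀ᶠ N in nhds L, 0 < planeDet N ∧ planeTrace L - 1 < planeTrace N :=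
    (continuous_planeDet.continuousAt.eventually_const_lt hL).and
      (continuous_planeTrace.continuousAt.eventually_const_lt (by linarith))
  obtain ⟨r, hr, hball⟩ := Metric.eventually_nhds_iff.1 h1
  refine ⟨r / 2, by positivity, 1 / (|planeTrace L| + 1), by positivity, ?_⟩
  intro κ ⟨hκ, hκ0⟩ M hM h
  set N : (ℝ × ℝ) →L[ℝ] ℝ × ℝ := κ⁻¹ • (M - 1)
  have hMN : M = 1 + κ • N := by simp [N, smul_smul, hκ.ne']
  have hN : ‖N - L‖ ≤ r / 2 := by
    refine ContinuousLinearMap.opNorm_le_bound _ (by positivity) fun v => ?_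
    have e : M v - v - κ • L v = κ • (N - L) v := by
      rw [hMN]; simp [smul_sub]
    have := h v
    rw [e, norm_smul, Real.norm_of_nonneg hκ.le, mul_assoc] at this
    exact le_of_mul_le_mul_left this hκ
  obtain ⟨hdet, htr⟩ := hball (show dist N L < r by rw [dist_eq_norm]; linarith)
  have e1 : planeTrace M = 2 + κ * planeTrace N := by
    rw [hMN]; simp [planeTrace]; ring
  have e2 : 1 + planeDet M - planeTrace M = κ ^ 2 * planeDet N := by
    rw [hMN]; simp [planeTrace, planeDet]; ring
  have e3 : 0 < κ ^ 2 * planeDet N := by positivity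
  have e4 : κ * (|planeTrace L| + 1) ≤ 1 := (le_div_iff₀ (by positivity)).1 hκ0
  have e5 := neg_abs_le (planeTrace L)
  rw [abs_lt]
  constructor
  · nlinarith
  · linarith

end PlaneMaps

section Periodic

/-- Gluing translates of a solution on one period. -/
theorem exists_periodic_extension {φ : ℝ → ℝ × ℝ → ℝ × ℝ} {T : ℝ} (hT : 0 < T)
    (hφ : ∀ t v, φ (t + T) v = φ t v) {α : ℝ → ℝ × ℝ}
    (hα : ∀ t ∈ Icc 0 T, HasDerivWithinAt α (φ t (α t)) (Icc 0 T) t) (hαT : α T = α 0) :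
    ∃ X : ℝ → ℝ × ℝ, IsSolution φ X ∧ Periodic X T ∧ ∀ t ∈ Icc 0 T, X t = α t := by
  set X : ℝ → ℝ × ℝ := fun t => α (toIcoMod hT 0 t)
  have hX : ∀ n : ℤ, ∀ t ∈ Icc (n * T) (n * T + T), X t = α (t - n * T) := by
    intro n t ⟨h1, h2⟩
    rcases h2.eq_or_lt with h2 | h2
    · have e : toIcoMod hT 0 t = 0 :=
        (toIcoMod_eq_iff hT).2 ⟨⟨le_rfl, by simpa using hT⟩, n + 1, by simp; linarith⟩
      show α (toIcoMod hT 0 t) = _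
      rw [e, h2, add_sub_cancel_left, hαT]
    · have e : toIcoMod hT 0 t = t - n * T :=
        (toIcoMod_eq_iff hT).2 ⟨⟨by linarith, by linarith⟩, n, by simp⟩
      simp only [X, e]
  have hder : ∀ n : ℤ, ∀ t ∈ Icc (n * T) (n * T + T),
      HasDerivWithinAt X (φ t (X t)) (Icc (n * T) (n * T + T)) t := by
    intro n t ht
    have ht' : t - n * T ∈ Icc 0 T := ⟨by linarith [ht.1], by linarith [ht.2]⟩
    have hmaps : MapsTo (fun s : ℝ => s - n * T) (Icc (n * T) (n * T + T)) (Icc 0 T) :=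
      fun s hs => ⟨by linarith [hs.1], by linarith [hs.2]⟩
    have hshift : HasDerivWithinAt (fun s : ℝ => s - n * T) 1 (Icc (n * T) (n * T + T)) t :=
      ((hasDerivAt_id t).sub_const (n * T)).hasDerivWithinAt
    have h := (hα _ ht').scomp t hshift hmaps
    have hφn : φ (t - n * T) = φ t := by
      funext v
      exact Periodic.sub_int_mul_eq (f := fun t => φ t v) (fun t => hφ t v) n
    rw [one_smul, hφn, ← hX n t ht] at h
    exact h.congr (fun s hs => hX n s hs) (hX n t ht)
  refine ⟨X, fun t => ?_, fun t => by simp [X], fun t ht => by simpa using hX 0 t (by simpa using ht)⟩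
  have hr : HasDerivWithinAt X (φ t (X t)) (Ici t) t := by
    have h1 := (le_div_iff₀ hT).1 (Int.floor_le (t / T))
    have h2 := (div_lt_iff₀ hT).1 (Int.lt_floor_add_one (t / T))
    exact (hder ⌊t / T⌋ t ⟨h1, by linarith⟩).mono_of_mem_nhdsWithin
      (Icc_mem_nhdsGE_of_mem ⟨h1, by linarith⟩)
  have hl : HasDerivWithinAt X (φ t (X t)) (Iic t) t := by
    have h1 := (div_le_iff₀ hT).1 (Int.le_ceil (t / T))
    have h2 := (lt_div_iff₀ hT).1 (sub_lt_iff_lt_add.2 (Int.ceil_lt_add_one (t / T)))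
    have h3 : ((⌈t / T⌉ - 1 : ℤ) : ℝ) * T < t := by push_cast; exact h2
    have h4 : t ≤ ((⌈t / T⌉ - 1 : ℤ) : ℝ) * T + T := by push_cast; linarith
    exact (hder _ t ⟨h3.le, h4⟩).mono_of_mem_nhdsWithin (Icc_mem_nhdsLE_of_mem ⟨h3, h4⟩)
  have := hl.union hr
  rwa [Iic_union_Ici, hasDerivWithinAt_univ] at this

end Periodic

section Averaging

theorem exists_uniform_tube {E F : Type*} [NormedAddCommGroup E] [NormedAddCommGroup F]
    {g : ℝ → ℝ → E → F} (hg : Continuous fun z : ℝ × ℝ × E => g z.1 z.2.1 z.2.2) (x₀ : E) (T : ℝ)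
    {c : ℝ} (hc : 0 < c) :
    ∃ ρ > 0, ∀ η v t, |η| ≤ ρ → ‖v - x₀‖ ≤ ρ → t ∈ Icc 0 T → ‖g η t v - g 0 t x₀‖ ≤ c := by
  have h : ∀ᶠ z in nhds ((0, x₀) : ℝ × E), ∀ t ∈ Icc 0 T, ‖g z.1 t z.2 - g 0 t x₀‖ < c := by
    refine isCompact_Icc.eventually_forall_of_forall_eventually fun t _ => ?_
    have hcont : Continuous fun q : (ℝ × E) × ℝ => ‖g q.1.1 q.2 q.1.2 - g 0 q.2 x₀‖ :=
      ((hg.comp (f := fun q : (ℝ × E) × ℝ => (q.1.1, q.2, q.1.2)) (by fun_prop)).sub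
        (hg.comp (f := fun q : (ℝ × E) × ℝ => ((0 : ℝ), q.2, x₀)) (by fun_prop))).norm
    exact hcont.continuousAt.eventually_lt_const (by simpa using hc)
  obtain ⟨r, hr, hball⟩ := Metric.eventually_nhds_iff.1 h
  refine ⟨r / 2, by positivity, fun η v t hη hv ht => (hball (y := (η, v)) ?_ t ht).le⟩
  rw [Prod.dist_eq, dist_eq_norm, dist_eq_norm, sub_zero, Real.norm_eq_abs]
  exact max_lt (by linarith) (by linarith)

/-- Existence of a closed orbit for a slowly varying equation close to an averaged equation with a
nondegenerate equilibrium `x₀`. -/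
theorem exists_closed_orbit_of_near_average {E : Type*} [NormedAddCommGroup E] [NormedSpace ℝ E]
    [CompleteSpace E] {h : ℝ → E → E} {Dh : ℝ → E → E →L[ℝ] E} {B Ψ : ℝ → E →L[ℝ] E}
    {b ψ : ℝ → E} {x₀ : E} {k T ρ C Cf c c₁ c₂ : ℝ} (S : (Ψ T).NonlinearRightInverse)
    (hk : 0 < k) (hT : 0 < T) (hρ : 0 < ρ) (hC : 0 ≤ C) (hCf : 0 ≤ Cf) (hc : 0 ≤ c) (hc₁ : 0 ≤ c₁)
    (hDh : ∀ t v, HasFDerivAt (h t) (Dh t v) v) (hcont : ∀ v, Continuous fun t => h t v)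
    (hDhB : ∀ t ∈ Icc 0 T, ∀ v, ‖v - x₀‖ ≤ ρ → ‖Dh t v - B t‖ ≤ c₁)
    (hbound : ∀ t ∈ Icc 0 T, ∀ v, ‖v - x₀‖ ≤ ρ → ‖h t v‖ ≤ Cf)
    (hhb : ∀ t ∈ Icc 0 T, ∀ v, ‖v - x₀‖ ≤ k * Cf * T → ‖h t v - b t‖ ≤ c₂)
    (hB : ∀ t ∈ Icc 0 T, ‖B t‖ ≤ C) (hΨ : ∀ t, HasDerivAt Ψ (B t) t) (hΨ0 : Ψ 0 = 0)
    (hψ : ∀ t, HasDerivAt ψ (b t) t) (hψ0 : ψ 0 = 0) (hψT : ψ T = 0)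
    (hkρ : k * Cf * T ≤ ρ / 2) (hsmall : k * (C + c₁) * T ≤ 1 / 2)
    (hkc : T * (2 * c₁ + 2 * k * C * (C + c₁) * T) ≤ c)
    (hcS : c₂ * T ≤ ((S.nnnorm : ℝ)⁻¹ - c) * (ρ / 2)) :
    ∃ α : ℝ → E, (∀ t ∈ Icc 0 T, HasDerivWithinAt α (k • h t (α t)) (Icc 0 T) t) ∧
      α T = α 0 ∧ ∀ t ∈ Icc 0 T, ‖α t - x₀‖ ≤ ρ := by
  have h0T : (0 : ℝ) ∈ Icc 0 T := ⟨le_rfl, hT.le⟩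
  have hTT : T ∈ Icc 0 T := ⟨hT.le, le_rfl⟩
  have hconv : Convex ℝ {v : E | ‖v - x₀‖ ≤ ρ} := by
    have : {v : E | ‖v - x₀‖ ≤ ρ} = Metric.closedBall x₀ ρ := by
      ext v; simp [dist_eq_norm]
    rw [this]; exact convex_closedBall _ _
  have hlin : ∀ t ∈ Icc 0 T, ∀ v, ‖v - x₀‖ ≤ ρ → ∀ w, ‖w - x₀‖ ≤ ρ →
      ‖h t v - h t w - B t (v - w)‖ ≤ c₁ * ‖v - w‖ := fun t ht v hv w hw =>
    hconv.norm_image_sub_le_of_norm_hasFDerivWithin_le' (f' := Dh t)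
      (fun z _ => (hDh t z).hasFDerivWithinAt) (fun z hz => hDhB t ht z hz) hw hv
  have hlip : ∀ t ∈ Icc 0 T, ∀ v, ‖v - x₀‖ ≤ ρ → ∀ w, ‖w - x₀‖ ≤ ρ →
      ‖h t v - h t w‖ ≤ (C + c₁) * ‖v - w‖ := fun t ht v hv w hw => by
    have h1 := norm_add_le (h t v - h t w - B t (v - w)) (B t (v - w))
    rw [sub_add_cancel] at h1
    have h2 := (B t).le_opNorm (v - w)
    have h3 := mul_le_mul_of_nonneg_right (hB t ht) (norm_nonneg (v - w))
    linarith [hlin t ht v hv w hw]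
  have hsol : ∀ v, ∃ α : ℝ → E, ‖v - x₀‖ ≤ ρ / 2 → α 0 = v ∧
      (∀ t ∈ Icc 0 T, HasDerivWithinAt α (k • h t (α t)) (Icc 0 T) t) ∧
      ∀ t ∈ Icc 0 T, ‖α t - v‖ ≤ k * Cf * T := by
    intro v
    by_cases hv : ‖v - x₀‖ ≤ ρ / 2
    · have hin : ∀ z ∈ Metric.closedBall v (k * Cf * T), ‖z - x₀‖ ≤ ρ := fun z hz => by
        rw [mem_closedBall_iff_norm] at hz
        have := norm_add_le (z - v) (v - x₀)
        rw [sub_add_sub_cancel] at this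
        linarith
      obtain ⟨α, hα⟩ := exists_solution_Icc (f := fun t v => k • h t v) (T := T) (C := k * Cf)
        (K := k * (C + c₁)) (a := k * Cf * T) (x₀ := v) hT.le (by positivity) (by positivity)
        (by positivity)
        (fun t ht z hz w hw => by
          rw [← smul_sub, norm_smul, Real.norm_of_nonneg hk.le, mul_assoc]
          exact mul_le_mul_of_nonneg_left (hlip t ht z (hin z hz) w (hin w hw)) hk.le)
        (fun z _ => ((hcont z).const_smul k).continuousOn)
        (fun t ht z hz => by
          rw [norm_smul, Real.norm_of_nonneg hk.le]
          exact mul_le_mul_of_nonneg_left (hbound t ht z (hin z hz)) hk.le)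
        le_rfl
      exact ⟨α, fun _ => hα⟩
    · exact ⟨fun _ => 0, fun hv' => (hv hv').elim⟩
  choose α hα using hsol
  have hin : ∀ v, ‖v - x₀‖ ≤ ρ / 2 → ∀ t ∈ Icc 0 T, ‖α v t - x₀‖ ≤ ρ := fun v hv t ht => by
    have := norm_add_le (α v t - v) (v - x₀)
    rw [sub_add_sub_cancel] at this
    linarith [(hα v hv).2.2 t ht]
  have hx₀ : ‖x₀ - x₀‖ ≤ ρ / 2 := by simp; positivity
  set G : E → E := fun v => k⁻¹ • (α v T - v)
  lift c to NNReal using hc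
  have hG : ApproximatesLinearOn G (Ψ T) (Metric.closedBall x₀ (ρ / 2)) c := by
    intro v hv w hw
    rw [mem_closedBall_iff_norm] at hv hw
    have h1 := norm_sub_sub_le_of_near_linear (w := fun t => α v t - α w t)
      (w' := fun t => k • h t (α v t) - k • h t (α w t)) hk.le hc₁ hT.le hC
      (fun t ht => ((hα v hv).2.1 t ht).sub ((hα w hw).2.1 t ht)) hΨ hΨ0 hB
      (fun t ht => by
        rw [← smul_sub, ← smul_sub, norm_smul, Real.norm_of_nonneg hk.le, mul_assoc]
        exact mul_le_mul_of_nonneg_left (hlin t ht _ (hin v hv t ht) _ (hin w hw t ht)) hk.le)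
      hsmall
    simp only [(hα v hv).1, (hα w hw).1] at h1
    have e : α v T - α w T - (v - w) - k • Ψ T (v - w) = k • (G v - G w - Ψ T (v - w)) := by
      simp only [G, smul_sub, smul_inv_smul₀ hk.ne']
      abel
    rw [e, norm_smul, Real.norm_of_nonneg hk.le, mul_assoc, mul_assoc] at h1
    have h2 := le_of_mul_le_mul_left h1 hk
    rw [← mul_assoc] at h2
    exact h2.trans (mul_le_mul_of_nonneg_right hkc (norm_nonneg _))
  have hG0 : ‖G x₀‖ ≤ c₂ * T := by
    have h1 := norm_image_sub_le_of_norm_deriv_le_segment' (f := fun t => α x₀ t - k • ψ t)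
      (f' := fun t => k • h t (α x₀ t) - k • b t) (a := 0) (b := T) (C := k * c₂)
      (fun t ht => ((hα x₀ hx₀).2.1 t ht).sub ((hψ t).const_smul k).hasDerivWithinAt)
      (fun t ht => by
        rw [← smul_sub, norm_smul, Real.norm_of_nonneg hk.le]
        exact mul_le_mul_of_nonneg_left (hhb t (Ico_subset_Icc_self ht) _
          ((hα x₀ hx₀).2.2 t (Ico_subset_Icc_self ht))) hk.le) T hTT
    simp only [hψ0, hψT, smul_zero, sub_zero, (hα x₀ hx₀).1] at h1
    simp only [G]
    rw [norm_smul, norm_inv, Real.norm_of_nonneg hk.le, inv_mul_le_iff₀ hk]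
    linarith
  obtain ⟨v, hv, hGv⟩ := hG.surjOn_closedBall_of_nonlinearRightInverse S (by positivity)
    Subset.rfl (a := 0) (by
      rw [mem_closedBall_iff_norm, zero_sub, norm_neg]
      exact hG0.trans hcS)
  rw [mem_closedBall_iff_norm] at hv
  refine ⟨α v, (hα v hv).2.1, ?_, hin v hv⟩
  rw [(hα v hv).1]
  simp only [G] at hGv
  exact sub_eq_zero.1 ((smul_eq_zero_iff_right (inv_ne_zero hk.ne')).1 hGv)

/-- The time-`T` map of a linear plane equation with small coefficients of constant trace:
Liouville's formula and the first order expansion. -/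
theorem exists_monodromy {A B Ψ : ℝ → (ℝ × ℝ) →L[ℝ] ℝ × ℝ} {k T C c₁ d : ℝ}
    (hk : 0 < k) (hT : 0 < T) (hC : 0 ≤ C) (hc₁ : 0 ≤ c₁) (hA : Continuous A)
    (hAB : ∀ t ∈ Icc 0 T, ‖A t - B t‖ ≤ c₁) (hB : ∀ t ∈ Icc 0 T, ‖B t‖ ≤ C)
    (hΨ : ∀ t, HasDerivAt Ψ (B t) t) (hΨ0 : Ψ 0 = 0) (htr : ∀ t, planeTrace (A t) = -d)
    (hsmall : k * (C + c₁) * T ≤ 1 / 2) :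
    ∃ M : (ℝ × ℝ) →L[ℝ] ℝ × ℝ,
      (∀ v, ∃ z : ℝ → ℝ × ℝ, z 0 = v ∧ z T = M v ∧
        ∀ t ∈ Icc 0 T, HasDerivWithinAt z (k • A t (z t)) (Icc 0 T) t) ∧
      planeDet M = Real.exp (-(k * d * T)) ∧
      ∀ v, ‖M v - v - k • Ψ T v‖ ≤ k * T * (2 * c₁ + 2 * k * C * (C + c₁) * T) * ‖v‖ := by
  have hAC : ∀ t ∈ Icc 0 T, ‖A t‖ ≤ C + c₁ := fun t ht => by
    have := norm_add_le (A t - B t) (B t)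
    rw [sub_add_cancel] at this
    linarith [hAB t ht, hB t ht]
  have hTT : T ∈ Icc 0 T := ⟨hT.le, le_rfl⟩
  have hcol : ∀ v : ℝ × ℝ, ‖v‖ ≤ 1 → ∃ z : ℝ → ℝ × ℝ, z 0 = v ∧
      ∀ t ∈ Icc 0 T, HasDerivWithinAt z (k • A t (z t)) (Icc 0 T) t := by
    intro v hv
    obtain ⟨z, hz0, hz, -⟩ := exists_solution_Icc (f := fun t v => k • A t v) (T := T)
      (C := k * (C + c₁) * 2) (K := k * (C + c₁)) (a := 1) (x₀ := v) hT.le (by positivity)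
      (by positivity) zero_le_one
      (fun t ht x _ y _ => by
        rw [← smul_sub, ← map_sub, norm_smul, Real.norm_of_nonneg hk.le, mul_assoc]
        exact mul_le_mul_of_nonneg_left ((A t).le_of_opNorm_le (hAC t ht) _) hk.le)
      (fun x _ => by fun_prop)
      (fun t ht x hx => by
        rw [mem_closedBall_iff_norm] at hx
        have h2 : ‖x‖ ≤ 2 := by
          have := norm_add_le (x - v) v
          rw [sub_add_cancel] at this
          linarith
        rw [norm_smul, Real.norm_of_nonneg hk.le, mul_assoc]
        exact mul_le_mul_of_nonneg_left (((A t).le_of_opNorm_le (hAC t ht) _).trans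
          (mul_le_mul_of_nonneg_left h2 (by positivity))) hk.le)
      (by linarith)
    exact ⟨z, hz0, hz⟩
  obtain ⟨Φ₁, h10, h1⟩ := hcol (1, 0) (by simp [Prod.norm_def])
  obtain ⟨Φ₂, h20, h2⟩ := hcol (0, 1) (by simp [Prod.norm_def])
  set M : (ℝ × ℝ) →L[ℝ] ℝ × ℝ := (ContinuousLinearMap.fst ℝ ℝ ℝ).smulRight (Φ₁ T) +
    (ContinuousLinearMap.snd ℝ ℝ ℝ).smulRight (Φ₂ T)
  have hM : ∀ v, M v = v.1 • Φ₁ T + v.2 • Φ₂ T := fun v => by simp [M]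
  have hz : ∀ v : ℝ × ℝ, ∀ t ∈ Icc 0 T, HasDerivWithinAt (fun t => v.1 • Φ₁ t + v.2 • Φ₂ t)
      (k • A t (v.1 • Φ₁ t + v.2 • Φ₂ t)) (Icc 0 T) t := fun v t ht => by
    have := ((h1 t ht).const_smul v.1).add ((h2 t ht).const_smul v.2)
    rw [map_add, map_smul, map_smul, smul_add, smul_comm k v.1, smul_comm k v.2]
    exact this
  have hz0 : ∀ v : ℝ × ℝ, v.1 • Φ₁ 0 + v.2 • Φ₂ 0 = v := fun v => by
    rw [h10, h20]; ext <;> simp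
  refine ⟨M, fun v => ⟨_, hz0 v, (hM v).symm, hz v⟩, ?_, fun v => ?_⟩
  · have hfst : ∀ {Φ : ℝ → ℝ × ℝ} {Φ' : ℝ × ℝ} {t : ℝ}, HasDerivWithinAt Φ Φ' (Icc 0 T) t →
        HasDerivWithinAt (fun t => (Φ t).1) Φ'.1 (Icc 0 T) t := fun h =>
      (ContinuousLinearMap.fst ℝ ℝ ℝ).hasFDerivAt.comp_hasDerivWithinAt _ h
    have hsnd : ∀ {Φ : ℝ → ℝ × ℝ} {Φ' : ℝ × ℝ} {t : ℝ}, HasDerivWithinAt Φ Φ' (Icc 0 T) t →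
        HasDerivWithinAt (fun t => (Φ t).2) Φ'.2 (Icc 0 T) t := fun h =>
      (ContinuousLinearMap.snd ℝ ℝ ℝ).hasFDerivAt.comp_hasDerivWithinAt _ h
    set W : ℝ → ℝ := fun t => ((Φ₁ t).1 * (Φ₂ t).2 - (Φ₂ t).1 * (Φ₁ t).2) * Real.exp (k * d * t)
    have hW : ∀ t ∈ Icc 0 T, HasDerivWithinAt W 0 (Icc 0 T) t := fun t ht => by
      have he : HasDerivAt (fun t => Real.exp (k * d * t)) (Real.exp (k * d * t) * (k * d)) t := by
        simpa using ((hasDerivAt_id t).const_mul (k * d)).exp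
      have := ((((hfst (h1 t ht)).mul (hsnd (h2 t ht))).sub
        ((hfst (h2 t ht)).mul (hsnd (h1 t ht)))).mul he.hasDerivWithinAt)
      refine this.congr_deriv ?_
      have htr := htr t
      rw [planeTrace] at htr
      rw [plane_map_apply (A t) (Φ₁ t), plane_map_apply (A t) (Φ₂ t)]
      simp only [Prod.smul_fst, Prod.smul_snd, Prod.fst_add, Prod.snd_add, smul_eq_mul, Pi.sub_apply,
        Pi.mul_apply]
      linear_combination (k * ((Φ₁ t).1 * (Φ₂ t).2 - (Φ₂ t).1 * (Φ₁ t).2) *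
        Real.exp (k * d * t)) * htr
    have hWT := norm_image_sub_le_of_norm_deriv_le_segment' (C := 0) hW (by simp) T hTT
    rw [zero_mul, norm_le_zero_iff, sub_eq_zero] at hWT
    simp only [W, h10, h20] at hWT
    rw [Real.exp_neg, planeDet, hM, hM]
    refine eq_inv_of_mul_eq_one_left ?_
    simpa using hWT
  · have := norm_sub_sub_le_of_near_linear hk.le hc₁ hT.le hC (hz v) hΨ hΨ0 hB
      (fun t ht => by
        rw [← smul_sub, ← sub_apply, norm_smul, Real.norm_of_nonneg hk.le,
          mul_assoc]
        exact mul_le_mul_of_nonneg_left ((A t - B t).le_of_opNorm_le (hAB t ht) _) hk.le) hsmall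
    rwa [hz0, ← hM] at this

/-- Averaging: an equation `v' = κ f(η, t, v)` with trace of negative sign and with a
nondegenerate equilibrium of the averaged equation having positive determinant has an
asymptotically stable periodic solution close to the equilibrium. -/
theorem exists_stable_periodic_of_averaging {f : ℝ → ℝ → ℝ × ℝ → ℝ × ℝ}
    {Df : ℝ → ℝ → ℝ × ℝ → (ℝ × ℝ) →L[ℝ] ℝ × ℝ} {κ : ℝ → ℝ} {x₀ : ℝ × ℝ}
    {Ψ : ℝ → (ℝ × ℝ) →L[ℝ] ℝ × ℝ} {ψ : ℝ → ℝ × ℝ} {T : ℝ} (hT : 0 < T)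
    (hf : ∀ η t v, HasFDerivAt (f η t) (Df η t v) v)
    (hfc : Continuous fun z : ℝ × ℝ × ℝ × ℝ => f z.1 z.2.1 z.2.2)
    (hDfc : Continuous fun z : ℝ × ℝ × ℝ × ℝ => Df z.1 z.2.1 z.2.2)
    (hper : ∀ η t v, f η (t + T) v = f η t v)
    (hκ : Tendsto κ (nhdsWithin 0 (Ioi 0)) (nhds 0)) (hκpos : ∀ η > 0, 0 < κ η)
    (htr : ∀ η > 0, ∃ d > 0, ∀ t v, planeTrace (Df η t v) = -d)
    (hΨ : ∀ t, HasDerivAt Ψ (Df 0 t x₀) t) (hΨ0 : Ψ 0 = 0) (hdet : 0 < planeDet (Ψ T))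
    (hψ : ∀ t, HasDerivAt ψ (f 0 t x₀) t) (hψ0 : ψ 0 = 0) (hψT : ψ T = 0) :
    ∃ η₀ > 0, ∀ η ∈ Ioc 0 η₀, ∃ X, IsSolution (fun t v => κ η • f η t v) X ∧ Periodic X T ∧
      IsAsympStable (fun t v => κ η • f η t v) X ∧ ‖X 0 - x₀‖ ≤ 1 := by
  obtain ⟨c₀, hc₀, κ₀, hκ₀, hjury⟩ := exists_abs_planeTrace_lt hdet
  have hsurj : (Ψ T).range = ⊤ := LinearMap.range_eq_top.2 (surjective_of_planeDet_pos hdet)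
  set S := ContinuousLinearMap.nonlinearRightInverseOfSurjective (Ψ T) hsurj
  have hS : (0 : ℝ) < (S.nnnorm : ℝ)⁻¹ := by
    have := ContinuousLinearMap.nonlinearRightInverseOfSurjective_nnnorm_pos (Ψ T) hsurj
    exact inv_pos.2 (NNReal.coe_pos.2 this)
  set s := (S.nnnorm : ℝ)⁻¹
  set c := min c₀ (s / 2)
  have hc : 0 < c := lt_min hc₀ (by positivity)
  have hBc : Continuous fun t => Df 0 t x₀ :=
    hDfc.comp (f := fun t : ℝ => ((0 : ℝ), t, x₀)) (by fun_prop)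
  obtain ⟨C, hC⟩ := isCompact_Icc.exists_bound_of_continuousOn (s := Icc 0 T) hBc.continuousOn
  have hbc : Continuous fun t => f 0 t x₀ :=
    hfc.comp (f := fun t : ℝ => ((0 : ℝ), t, x₀)) (by fun_prop)
  obtain ⟨C', hC'⟩ := isCompact_Icc.exists_bound_of_continuousOn (s := Icc 0 T) hbc.continuousOn
  have h0T : (0 : ℝ) ∈ Icc 0 T := ⟨le_rfl, hT.le⟩
  have hC0 : 0 ≤ C := (norm_nonneg _).trans (hC 0 h0T)
  have hC0' : 0 ≤ C' := (norm_nonneg _).trans (hC' 0 h0T)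
  set c₁ := c / (4 * T)
  have hc₁ : 0 < c₁ := by positivity
  obtain ⟨ρ₁, hρ₁, htube₁⟩ := exists_uniform_tube hDfc x₀ T hc₁
  obtain ⟨ρ₂, hρ₂, htube₂⟩ := exists_uniform_tube hfc x₀ T one_pos
  set ρ := min (min ρ₁ ρ₂) 1
  have hρ : 0 < ρ := lt_min (lt_min hρ₁ hρ₂) one_pos
  have hρρ₁ : ρ ≤ ρ₁ := (min_le_left _ _).trans (min_le_left _ _)
  have hρρ₂ : ρ ≤ ρ₂ := (min_le_left _ _).trans (min_le_right _ _)
  set c₂ := s / 2 * (ρ / 2) / T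
  have hc₂ : 0 < c₂ := by positivity
  obtain ⟨ρ₃, hρ₃, htube₃⟩ := exists_uniform_tube hfc x₀ T hc₂
  have hlt : ∀ g : ℝ → ℝ, Continuous g → g 0 = 0 → ∀ r > 0,
      ∀ᶠ η in nhdsWithin 0 (Ioi 0), g (κ η) < r := fun g hg hg0 r hr =>
    ((hg.tendsto 0).comp hκ).eventually_lt_const (by rw [hg0]; exact hr)
  have hη : ∀ r > 0, ∀ᶠ η : ℝ in nhdsWithin 0 (Ioi 0), η < r := fun r hr =>
    Filter.Eventually.filter_mono nhdsWithin_le_nhds (eventually_lt_nhds hr)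
  have hall := (hη ρ hρ).and <| (hη ρ₃ hρ₃).and <|
    (hlt (fun k => k) (by fun_prop) rfl κ₀ hκ₀).and <|
    (hlt (fun k => k * (C' + 1) * T) (by fun_prop) (by simp) (ρ / 2) (by positivity)).and <|
    (hlt (fun k => k * (C' + 1) * T) (by fun_prop) (by simp) ρ₃ hρ₃).and <|
    (hlt (fun k => k * (C + c₁) * T) (by fun_prop) (by simp) (1 / 2) (by norm_num)).and
    (hlt (fun k => T * (2 * k * C * (C + c₁) * T)) (by fun_prop) (by simp) (c / 2) (by positivity))
  obtain ⟨r, hr, hsub⟩ := mem_nhdsGT_iff_exists_Ioc_subset.1 hall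
  refine ⟨r, hr, fun η hη => ?_⟩
  obtain ⟨e1, e2, e3, e4, e5, e6, e7⟩ := hsub hη
  have hk := hκpos η hη.1
  obtain ⟨d, hd, htr⟩ := htr η hη.1
  have habs : |η| = η := abs_of_pos hη.1
  have hDhB : ∀ t ∈ Icc 0 T, ∀ v, ‖v - x₀‖ ≤ ρ → ‖Df η t v - Df 0 t x₀‖ ≤ c₁ := fun t ht v hv =>
    htube₁ η v t (by linarith) (by linarith) ht
  have hkc : T * (2 * c₁ + 2 * κ η * C * (C + c₁) * T) ≤ c := by
    have : T * (2 * c₁) = c / 2 := by simp only [c₁]; field_simp; norm_num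
    rw [mul_add]
    linarith
  obtain ⟨α, hα, hαT, hαρ⟩ := exists_closed_orbit_of_near_average (h := f η) (Dh := Df η)
    (B := fun t => Df 0 t x₀) (b := fun t => f 0 t x₀) (c₁ := c₁) (c₂ := c₂) (C := C)
    (Cf := C' + 1) S hk hT hρ hC0 (by positivity) hc.le hc₁.le (hf η)
    (fun v => hfc.comp (f := fun t : ℝ => (η, t, v)) (by fun_prop)) hDhB
    (fun t ht v hv => by
      have h1 := norm_add_le (f η t v - f 0 t x₀) (f 0 t x₀)
      rw [sub_add_cancel] at h1
      linarith [hC' t ht, htube₂ η v t (by linarith) (by linarith) ht])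
    (fun t ht v hv => htube₃ η v t (by linarith) (by linarith) ht)
    hC hΨ hΨ0 hψ hψ0 hψT e4.le e6.le hkc (by
      have h1 : c₂ * T = s / 2 * (ρ / 2) := by simp only [c₂]; field_simp
      have h2 : c ≤ s / 2 := min_le_right _ _
      rw [h1]
      exact mul_le_mul_of_nonneg_right (by linarith) (by positivity))
  have hφper : ∀ t v, κ η • f η (t + T) v = κ η • f η t v := fun t v => by rw [hper]
  obtain ⟨X, hX, hXT, hXα⟩ := exists_periodic_extension (φ := fun t v => κ η • f η t v) hT hφper
    hα hαT
  have hXc : Continuous X := hX.continuous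
  obtain ⟨M, hM, hMdet, hMest⟩ := exists_monodromy (A := fun t => Df η t (X t)) (d := d) hk hT hC0
    hc₁.le (hDfc.comp (f := fun t : ℝ => (η, t, X t)) (by fun_prop))
    (fun t ht => hDhB t ht _ (by rw [hXα t ht]; exact hαρ t ht)) hC hΨ hΨ0 (fun t => htr t _) e6.le
  have hMpos : 0 < planeDet M := by rw [hMdet]; positivity
  have hMlt : planeDet M < 1 := by
    rw [hMdet, Real.exp_lt_one_iff]
    have : 0 < κ η * d * T := by positivity
    linarith
  have htrM := hjury (κ η) ⟨hk, e3.le⟩ M hMpos fun v => (hMest v).trans (by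
    refine mul_le_mul_of_nonneg_right ?_ (norm_nonneg _)
    rw [mul_assoc]
    exact mul_le_mul_of_nonneg_left (hkc.trans (min_le_left _ _)) hk.le)
  obtain ⟨N, hN, hMN⟩ := exists_pow_contracting hMlt htrM
  refine ⟨X, hX, hXT, isAsympStable_of_pow_contracting (Dφ := fun t v => κ η • Df η t v) hT hφper
    (fun t v => (hf η t v).const_smul (κ η)) ?_ hX hXT hM hN hMN, ?_⟩
  · exact (hDfc.comp (f := fun z : ℝ × ℝ × ℝ => (η, z.1, z.2)) (by fun_prop)).const_smul (κ η)
  · rw [hXα 0 h0T]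
    exact (hαρ 0 h0T).trans (min_le_right _ _)

end Averaging

section RotatingFrame

/-- The plane map with matrix `!![a, b; c, d]`. -/
def planeMap (a b c d : ℝ) : (ℝ × ℝ) →L[ℝ] ℝ × ℝ :=
  a • (ContinuousLinearMap.inl ℝ ℝ ℝ ∘L ContinuousLinearMap.fst ℝ ℝ ℝ) +
  b • (ContinuousLinearMap.inl ℝ ℝ ℝ ∘L ContinuousLinearMap.snd ℝ ℝ ℝ) +
  c • (ContinuousLinearMap.inr ℝ ℝ ℝ ∘L ContinuousLinearMap.fst ℝ ℝ ℝ) +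
  d • (ContinuousLinearMap.inr ℝ ℝ ℝ ∘L ContinuousLinearMap.snd ℝ ℝ ℝ)

@[simp]
theorem planeMap_apply (a b c d : ℝ) (v : ℝ × ℝ) :
    planeMap a b c d v = (a * v.1 + b * v.2, c * v.1 + d * v.2) := by
  ext <;> simp [planeMap]

theorem hasDerivAt_planeMap {a b c d : ℝ → ℝ} {a' b' c' d' t : ℝ} (ha : HasDerivAt a a' t)
    (hb : HasDerivAt b b' t) (hc : HasDerivAt c c' t) (hd : HasDerivAt d d' t) :
    HasDerivAt (fun t => planeMap (a t) (b t) (c t) (d t)) (planeMap a' b' c' d') t := by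
  have h : ∀ {f : ℝ → ℝ} {f' : ℝ} (A : (ℝ × ℝ) →L[ℝ] ℝ × ℝ), HasDerivAt f f' t →
      HasDerivAt (fun t => f t • A) (f' • A) t := fun A hf => hf.smul_const A
  exact (((h _ ha).add (h _ hb)).add (h _ hc)).add (h _ hd)

/-- Radial deviation (divided by `η ^ 2`) of the point with slow coordinates `w`. -/
noncomputable def slowRadius (q : ℕ) (η t : ℝ) (w : ℝ × ℝ) : ℝ := w.1 - η ^ (2 * q) * Real.cos (2 * t) / 4

/-- Value of `(x₁² + x₂² - 2) / η ^ 2` at the point with slow coordinates `w`. -/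
noncomputable def slowEnergy (q : ℕ) (η t : ℝ) (w : ℝ × ℝ) : ℝ :=
  2 * √2 * slowRadius q η t w + η ^ 2 * slowRadius q η t w ^ 2 + w.2 ^ 2

/-- The point of the plane with slow coordinates `w` at time `t`. -/
noncomputable def ofSlow (q : ℕ) (η t : ℝ) (w : ℝ × ℝ) : ℝ × ℝ :=
  ((√2 + η ^ 2 * slowRadius q η t w) * Real.sin t + η * w.2 * Real.cos t,
    (√2 + η ^ 2 * slowRadius q η t w) * Real.cos t - η * w.2 * Real.sin t)

/-- The slow coordinates of a point `x` of the plane at time `t`. -/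
noncomputable def toSlow (q : ℕ) (η t : ℝ) (x : ℝ × ℝ) : ℝ × ℝ :=
  ((x.1 * Real.sin t + x.2 * Real.cos t - √2) / η ^ 2 + η ^ (2 * q) * Real.cos (2 * t) / 4,
    (x.1 * Real.cos t - x.2 * Real.sin t) / η)

/-- The vector field in slow coordinates, divided by `η ^ (2 * q + 1)`. -/
noncomputable def slowField (q : ℕ) (η t : ℝ) (w : ℝ × ℝ) : ℝ × ℝ :=
  (-(slowEnergy q η t w ^ (q + 1) * w.2 / 4) - η ^ (2 * q + 1) * (ofSlow q η t w).2 * Real.cos t,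
    (√2 + η ^ 2 * slowRadius q η t w) * slowEnergy q η t w ^ (q + 1) / 4 - Real.sin t ^ 2
      + η ^ (2 * q + 2) * (ofSlow q η t w).2 * Real.sin t)

/-- The space derivative of `slowField`. -/
noncomputable def slowFieldDeriv (q : ℕ) (η t : ℝ) (w : ℝ × ℝ) : (ℝ × ℝ) →L[ℝ] ℝ × ℝ :=
  planeMap
    (-((q + 1) * slowEnergy q η t w ^ q * (2 * (√2 + η ^ 2 * slowRadius q η t w)) * w.2 / 4)
      - η ^ (2 * q + 3) * Real.cos t ^ 2)
    (-((q + 1) * slowEnergy q η t w ^ q * (2 * w.2) * w.2 + slowEnergy q η t w ^ (q + 1)) / 4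
      + η ^ (2 * q + 2) * Real.sin t * Real.cos t)
    (η ^ 2 * slowEnergy q η t w ^ (q + 1) / 4 + (√2 + η ^ 2 * slowRadius q η t w) *
      ((q + 1) * slowEnergy q η t w ^ q * (2 * (√2 + η ^ 2 * slowRadius q η t w))) / 4
      + η ^ (2 * q + 4) * Real.cos t * Real.sin t)
    ((√2 + η ^ 2 * slowRadius q η t w) * ((q + 1) * slowEnergy q η t w ^ q * (2 * w.2)) / 4
      - η ^ (2 * q + 3) * Real.sin t ^ 2)

theorem continuous_slowField (q : ℕ) :
    Continuous fun z : ℝ × ℝ × ℝ × ℝ => slowField q z.1 z.2.1 z.2.2 := by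
  unfold slowField ofSlow slowEnergy slowRadius
  fun_prop

theorem continuous_slowFieldDeriv (q : ℕ) :
    Continuous fun z : ℝ × ℝ × ℝ × ℝ => slowFieldDeriv q z.1 z.2.1 z.2.2 := by
  unfold slowFieldDeriv slowEnergy slowRadius planeMap
  fun_prop

theorem hasFDerivAt_slowField (q : ℕ) (η t : ℝ) (w : ℝ × ℝ) :
    HasFDerivAt (slowField q η t) (slowFieldDeriv q η t w) w := by
  have hb : HasFDerivAt (fun w : ℝ × ℝ => w.2) (ContinuousLinearMap.snd ℝ ℝ ℝ) w := hasFDerivAt_snd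
  have hD : HasFDerivAt (slowRadius q η t) (ContinuousLinearMap.fst ℝ ℝ ℝ) w :=
    hasFDerivAt_fst.sub_const _
  have hu := (hD.const_mul (η ^ 2)).const_add √2
  have hE : HasFDerivAt (slowEnergy q η t) _ w :=
    ((hD.const_mul (2 * √2)).add ((hD.pow 2).const_mul (η ^ 2))).add (hb.pow 2)
  have hP := hE.pow (q + 1)
  have hx : HasFDerivAt (fun w => (ofSlow q η t w).2) _ w :=
    (hu.mul_const (Real.cos t)).sub ((hb.const_mul η).mul_const (Real.sin t))
  have h1 := (((hP.mul hb).mul_const (4⁻¹ : ℝ)).neg).sub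
    ((hx.const_mul (η ^ (2 * q + 1))).mul_const (Real.cos t))
  have h2 := (((hu.mul hP).mul_const (4⁻¹ : ℝ)).sub_const (Real.sin t ^ 2)).add
    ((hx.const_mul (η ^ (2 * q + 2))).mul_const (Real.sin t))
  refine (h1.prodMk h2).congr_fderiv ?_
  ext <;> simp [slowFieldDeriv] <;> ring

theorem slowField_add_two_pi (q : ℕ) (η t : ℝ) (w : ℝ × ℝ) :
    slowField q η (t + 2 * Real.pi) w = slowField q η t w := by
  have h : Real.cos (2 * (t + 2 * Real.pi)) = Real.cos (2 * t) := by
    have := Real.cos_add_nat_mul_two_pi (2 * t) 2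
    push_cast at this
    rw [← this]; ring_nf
  simp only [slowField, slowEnergy, ofSlow, slowRadius, h, Real.sin_add_two_pi,
    Real.cos_add_two_pi]

theorem ofSlow_add_two_pi (q : ℕ) (η t : ℝ) (w : ℝ × ℝ) :
    ofSlow q η (t + 2 * Real.pi) w = ofSlow q η t w := by
  have h : Real.cos (2 * (t + 2 * Real.pi)) = Real.cos (2 * t) := by
    have := Real.cos_add_nat_mul_two_pi (2 * t) 2
    push_cast at this
    rw [← this]; ring_nf
  simp only [ofSlow, slowRadius, h, Real.sin_add_two_pi, Real.cos_add_two_pi]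

theorem planeTrace_slowFieldDeriv (q : ℕ) (η t : ℝ) (w : ℝ × ℝ) :
    planeTrace (slowFieldDeriv q η t w) = -η ^ (2 * q + 3) := by
  simp only [planeTrace, slowFieldDeriv, planeMap_apply, mul_one, mul_zero, add_zero, zero_add]
  linear_combination -η ^ (2 * q + 3) * Real.sin_sq_add_cos_sq t

/-- The slow equation has an asymptotically stable periodic solution staying close to the
averaged equilibrium. -/
theorem exists_stable_periodic_slowField (q : ℕ) :
    ∃ w₀ : ℝ × ℝ, ∃ η₀ > 0, ∀ η ∈ Ioc 0 η₀, ∃ W,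
      IsSolution (fun t w => η ^ (2 * q + 1) • slowField q η t w) W ∧
      Periodic W (2 * Real.pi) ∧
      IsAsympStable (fun t w => η ^ (2 * q + 1) • slowField q η t w) W ∧ ‖W 0 - w₀‖ ≤ 1 := by
  have h2 : √2 * √2 = (2 : ℝ) := Real.mul_self_sqrt (by norm_num)
  have hs2 : 0 < √2 := by positivity
  obtain ⟨r, hr, hrq⟩ : ∃ r : ℝ, 0 < r ∧ r ^ (q + 1) = √2 :=
    ⟨√2 ^ (((q + 1 : ℕ) : ℝ)⁻¹), by positivity, Real.rpow_inv_natCast_pow hs2.le (by omega)⟩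
  set e : ℝ := 0 ^ (2 * q)
  have hE : ∀ t, slowEnergy q 0 t (r / (2 * √2), 0) = r - e * (√2 / 2) * Real.cos (2 * t) :=
    fun t => by
      simp only [slowEnergy, slowRadius]
      field_simp
      ring
  have hEq : ∀ t, slowEnergy q 0 t (r / (2 * √2), 0) ^ q = r ^ q := fun t => by
    rw [hE]
    rcases Nat.eq_zero_or_pos q with h | h
    · simp [h]
    · have : e = 0 := zero_pow (by omega)
      simp [this]
  have hEq1 : ∀ t, slowEnergy q 0 t (r / (2 * √2), 0) ^ (q + 1) =
      √2 - e * (√2 / 2) * Real.cos (2 * t) := fun t => by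
    rw [hE]
    rcases Nat.eq_zero_or_pos q with h | h
    · subst h
      rw [zero_add, pow_one] at *
      rw [hrq]
    · have : e = 0 := zero_pow (by omega)
      simp [this, hrq]
  have hsin : ∀ t, HasDerivAt (fun t => Real.sin (2 * t)) (2 * Real.cos (2 * t)) t := fun t => by
    have := ((hasDerivAt_id t).const_mul 2).sin
    simpa [mul_comm] using this
  have hsin4 : Real.sin (2 * (2 * Real.pi)) = 0 := by
    have := Real.sin_nat_mul_pi 4
    push_cast at this
    rw [← this]; ring_nf
  have hD : ∀ t, slowFieldDeriv q 0 t (r / (2 * √2), 0) =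
      planeMap 0 (-(√2 - e * (√2 / 2) * Real.cos (2 * t)) / 4) ((q + 1) * r ^ q) 0 := fun t => by
    unfold slowFieldDeriv
    rw [hEq, hEq1]
    congr 1
    · simp
    · simp
    · simp
      linear_combination ((q : ℝ) + 1) * r ^ q / 2 * h2
    · simp
  have hf : ∀ t, slowField q 0 t (r / (2 * √2), 0) =
      (0, (1 / 2 - e / 4) * Real.cos (2 * t)) := fun t => by
    unfold slowField
    rw [hEq1]
    ext
    · simp
    · simp
      rw [Real.sin_sq_eq_half_sub]
      linear_combination (1 / 4 - e / 8 * Real.cos (2 * t)) * h2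
  refine ⟨_, exists_stable_periodic_of_averaging (x₀ := (r / (2 * √2), 0))
    (κ := fun η => η ^ (2 * q + 1))
    (Ψ := fun t => planeMap 0 (-(√2 * t - e * (√2 / 2) * (Real.sin (2 * t) / 2)) / 4)
      ((q + 1) * r ^ q * t) 0)
    (ψ := fun t => (0, (1 / 2 - e / 4) * (Real.sin (2 * t) / 2)))
    Real.two_pi_pos (hasFDerivAt_slowField q) (continuous_slowField q)
    (continuous_slowFieldDeriv q) (slowField_add_two_pi q) ?_ (fun η hη => by positivity)
    (fun η hη => ⟨η ^ (2 * q + 3), by positivity, planeTrace_slowFieldDeriv q η⟩)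
    (fun t => ?_) ?_ ?_ (fun t => ?_) ?_ ?_⟩
  · have : Continuous fun η : ℝ => η ^ (2 * q + 1) := by fun_prop
    simpa using (this.tendsto 0).mono_left nhdsWithin_le_nhds
  · rw [hD]
    have h1 : HasDerivAt (fun t => -(√2 * t - e * (√2 / 2) * (Real.sin (2 * t) / 2)) / 4)
        (-(√2 - e * (√2 / 2) * Real.cos (2 * t)) / 4) t :=
      ((((hasDerivAt_id t).const_mul √2).sub
        (((hsin t).div_const 2).const_mul (e * (√2 / 2)))).neg.div_const 4).congr_deriv (by ring)
    have h3 : HasDerivAt (fun t => (q + 1) * r ^ q * t) ((q + 1) * r ^ q) t :=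
      ((hasDerivAt_id t).const_mul _).congr_deriv (by ring)
    exact hasDerivAt_planeMap (hasDerivAt_const t 0) h1 h3 (hasDerivAt_const t 0)
  · ext <;> simp
  · simp only [planeDet, planeMap_apply, hsin4]
    have : 0 < √2 * (2 * Real.pi) * ((q + 1) * r ^ q * (2 * Real.pi)) := by positivity
    simp
    nlinarith
  · rw [hf]
    exact (hasDerivAt_const t 0).prodMk
      ((((hsin t).div_const 2).const_mul (1 / 2 - e / 4)).congr_deriv (by ring))
  · simp
  · simp [hsin4]

end RotatingFrame

section OriginalCoordinates

/-- Asymptotic stability is inherited along a Lipschitz change of coordinates. -/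
theorem IsAsympStable.of_lipschitz_conj {φ F : ℝ → ℝ × ℝ → ℝ × ℝ} {X x : ℝ → ℝ × ℝ} {C : ℝ}
    (hX : IsAsympStable φ X) (hC : 0 < C)
    (h : ∀ y, IsSolution F y → ∃ Y, IsSolution φ Y ∧ ‖Y 0 - X 0‖ ≤ C * ‖y 0 - x 0‖ ∧
      ∀ t, ‖y t - x t‖ ≤ C * ‖Y t - X t‖) :
    IsAsympStable F x := by
  obtain ⟨hstab, δ, hδ, hattr⟩ := hX
  refine ⟨fun η hη => ?_, δ / C, by positivity, fun y hy hy0 => ?_⟩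
  · obtain ⟨δ, hδ, hstab⟩ := hstab (η / C) (by positivity)
    refine ⟨δ / C, by positivity, fun y hy hy0 t ht => ?_⟩
    obtain ⟨Y, hY, hY0, hYt⟩ := h y hy
    have h1 := hstab Y hY (hY0.trans_lt (by rwa [lt_div_iff₀' hC] at hy0)) t ht
    rw [lt_div_iff₀' hC] at h1
    exact (hYt t).trans_lt h1
  · obtain ⟨Y, hY, hY0, hYt⟩ := h y hy
    have h1 := (hattr Y hY (hY0.trans_lt (by rwa [lt_div_iff₀' hC] at hy0))).const_mul C
    rw [mul_zero] at h1
    exact squeeze_zero (fun _ => norm_nonneg _) hYt h1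

/-- The forced nonlinear rotation. -/
noncomputable def forcedRotation (p : ℕ) (ε t : ℝ) (x : ℝ × ℝ) : ℝ × ℝ :=
  (x.2 * ((1 / 4) * (x.1 ^ 2 + x.2 ^ 2 - 2) ^ p + 1),
    -x.1 * ((1 / 4) * (x.1 ^ 2 + x.2 ^ 2 - 2) ^ p + 1) - ε ^ 2 * x.2 + ε * Real.sin t)

theorem ofSlow_energy (q : ℕ) (η t : ℝ) (w : ℝ × ℝ) :
    (ofSlow q η t w).1 ^ 2 + (ofSlow q η t w).2 ^ 2 - 2 = η ^ 2 * slowEnergy q η t w := by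
  have h2 : √2 * √2 = (2 : ℝ) := Real.mul_self_sqrt (by norm_num)
  simp only [ofSlow, slowEnergy]
  linear_combination ((√2 + η ^ 2 * slowRadius q η t w) ^ 2 + (η * w.2) ^ 2) *
    Real.sin_sq_add_cos_sq t + h2

theorem ofSlow_toSlow (q : ℕ) {η : ℝ} (hη : η ≠ 0) (t : ℝ) (x : ℝ × ℝ) :
    ofSlow q η t (toSlow q η t x) = x := by
  have hu : √2 + η ^ 2 * slowRadius q η t (toSlow q η t x) =
      x.1 * Real.sin t + x.2 * Real.cos t := by
    simp only [slowRadius, toSlow]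
    field_simp
    ring
  have hv : η * (toSlow q η t x).2 = x.1 * Real.cos t - x.2 * Real.sin t := by
    simp only [toSlow]
    field_simp
  ext
  · simp only [ofSlow, hu, hv]
    linear_combination x.1 * Real.sin_sq_add_cos_sq t
  · simp only [ofSlow, hu, hv]
    linear_combination x.2 * Real.sin_sq_add_cos_sq t

theorem hasDerivAt_cos_two_mul (t : ℝ) :
    HasDerivAt (fun t => Real.cos (2 * t)) (-(4 * Real.sin t * Real.cos t)) t := by
  refine (((hasDerivAt_id t).const_mul 2).cos).congr_deriv ?_
  simp only [id, mul_one, Real.sin_two_mul]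
  ring

theorem forcedRotation_ofSlow (q : ℕ) (η t : ℝ) (w : ℝ × ℝ) :
    forcedRotation (q + 1) (η ^ (2 * q + 2)) t (ofSlow q η t w) =
      ((ofSlow q η t w).2 * (η ^ (2 * q + 2) * slowEnergy q η t w ^ (q + 1) / 4 + 1),
        -(ofSlow q η t w).1 * (η ^ (2 * q + 2) * slowEnergy q η t w ^ (q + 1) / 4 + 1)
          - (η ^ (2 * q + 2)) ^ 2 * (ofSlow q η t w).2 + η ^ (2 * q + 2) * Real.sin t) := by
  have e : (η ^ 2) ^ (q + 1) = η ^ (2 * q + 2) := by rw [← pow_mul]; ring_nf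
  rw [forcedRotation, ofSlow_energy, mul_pow, e]
  ext <;> simp only <;> ring

theorem hasDerivAt_ofSlow {q : ℕ} {η t : ℝ} {w : ℝ → ℝ × ℝ}
    (hw : HasDerivAt w (η ^ (2 * q + 1) • slowField q η t (w t)) t) :
    HasDerivAt (fun t => ofSlow q η t (w t))
      (forcedRotation (q + 1) (η ^ (2 * q + 2)) t (ofSlow q η t (w t))) t := by
  rw [forcedRotation_ofSlow]
  have h1 : HasDerivAt (fun t => (w t).1) (η ^ (2 * q + 1) * (slowField q η t (w t)).1) t :=
    (ContinuousLinearMap.fst ℝ ℝ ℝ).hasFDerivAt.comp_hasDerivAt t hw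
  have h2 : HasDerivAt (fun t => (w t).2) (η ^ (2 * q + 1) * (slowField q η t (w t)).2) t :=
    (ContinuousLinearMap.snd ℝ ℝ ℝ).hasFDerivAt.comp_hasDerivAt t hw
  have hD : HasDerivAt (fun t => slowRadius q η t (w t)) _ t :=
    h1.sub (((hasDerivAt_cos_two_mul t).const_mul (η ^ (2 * q))).div_const 4)
  have hu := (hD.const_mul (η ^ 2)).const_add √2
  have hv := h2.const_mul η
  have hs := Real.hasDerivAt_sin t
  have hc := Real.hasDerivAt_cos t
  refine (((hu.mul hs).add (hv.mul hc)).prodMk ((hu.mul hc).sub (hv.mul hs))).congr_deriv ?_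
  simp only [slowField]
  generalize slowEnergy q η t (w t) ^ (q + 1) = P
  ext
  · simp only [ofSlow]
    ring
  · simp only [ofSlow]
    linear_combination (-(η ^ (2 * q + 2)) ^ 2 * ((√2 + η ^ 2 * slowRadius q η t (w t)) *
      Real.cos t - η * (w t).2 * Real.sin t) + η ^ (2 * q + 2) * Real.sin t) *
      Real.sin_sq_add_cos_sq t

theorem hasDerivAt_toSlow {q : ℕ} {η t : ℝ} (hη : η ≠ 0) {x : ℝ → ℝ × ℝ}
    (hx : HasDerivAt x (forcedRotation (q + 1) (η ^ (2 * q + 2)) t (x t)) t) :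
    HasDerivAt (fun t => toSlow q η t (x t))
      (η ^ (2 * q + 1) • slowField q η t (toSlow q η t (x t))) t := by
  have hF := forcedRotation_ofSlow q η t (toSlow q η t (x t))
  have hu : √2 + η ^ 2 * slowRadius q η t (toSlow q η t (x t)) =
      (x t).1 * Real.sin t + (x t).2 * Real.cos t := by
    simp only [slowRadius, toSlow]
    field_simp
    ring
  rw [slowField, hu]
  rw [ofSlow_toSlow q hη] at hF ⊢
  rw [hF] at hx
  generalize slowEnergy q η t (toSlow q η t (x t)) ^ (q + 1) = P at *
  have h1 := (ContinuousLinearMap.fst ℝ ℝ ℝ).hasFDerivAt.comp_hasDerivAt t hx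
  have h2 := (ContinuousLinearMap.snd ℝ ℝ ℝ).hasFDerivAt.comp_hasDerivAt t hx
  have hs := Real.hasDerivAt_sin t
  have hc := Real.hasDerivAt_cos t
  refine ((((((h1.mul hs).add (h2.mul hc)).sub_const √2).div_const (η ^ 2)).add
    (((hasDerivAt_cos_two_mul t).const_mul (η ^ (2 * q))).div_const 4)).prodMk
    (((h1.mul hc).sub (h2.mul hs)).div_const η)).congr_deriv ?_
  ext
  · simp [toSlow]
    field_simp
    ring
  · simp [toSlow]
    field_simp
    ring

theorem norm_ofSlow_sub_le (q : ℕ) {η : ℝ} (hη : 0 < η) (t : ℝ) (w z : ℝ × ℝ) :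
    ‖ofSlow q η t w - ofSlow q η t z‖ ≤ (η ^ 2 + η) * ‖w - z‖ := by
  have h1 : |w.1 - z.1| ≤ ‖w - z‖ := norm_fst_le (w - z)
  have h2 : |w.2 - z.2| ≤ ‖w - z‖ := norm_snd_le (w - z)
  have key : ∀ a b : ℝ, |a| ≤ 1 → |b| ≤ 1 →
      |η ^ 2 * (w.1 - z.1) * a + η * (w.2 - z.2) * b| ≤ (η ^ 2 + η) * ‖w - z‖ := by
    intro a b ha hb
    refine (abs_add_le _ _).trans ?_
    rw [abs_mul, abs_mul, abs_mul, abs_mul, abs_of_pos hη, abs_of_pos (pow_pos hη 2), add_mul]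
    have h3 := mul_le_mul h1 ha (abs_nonneg _) (norm_nonneg _)
    have h4 := mul_le_mul h2 hb (abs_nonneg _) (norm_nonneg _)
    have h5 := mul_le_mul_of_nonneg_left h3 (pow_pos hη 2).le
    have h6 := mul_le_mul_of_nonneg_left h4 hη.le
    linarith
  have hs := Real.abs_sin_le_one t
  have hc := Real.abs_cos_le_one t
  rw [Prod.norm_def]
  refine max_le ?_ ?_
  · have e : (ofSlow q η t w - ofSlow q η t z).1 =
        η ^ 2 * (w.1 - z.1) * Real.sin t + η * (w.2 - z.2) * Real.cos t := by
      simp only [ofSlow, slowRadius, Prod.fst_sub]; ring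
    rw [e]
    exact key _ _ hs hc
  · have e : (ofSlow q η t w - ofSlow q η t z).2 =
        η ^ 2 * (w.1 - z.1) * Real.cos t + η * (w.2 - z.2) * -Real.sin t := by
      simp only [ofSlow, slowRadius, Prod.snd_sub]; ring
    rw [e]
    exact key _ _ hc (by rwa [abs_neg])

theorem norm_toSlow_sub_le (q : ℕ) {η : ℝ} (hη : 0 < η) (t : ℝ) (x y : ℝ × ℝ) :
    ‖toSlow q η t x - toSlow q η t y‖ ≤ (2 / η ^ 2 + 2 / η) * ‖x - y‖ := by
  have h1 : |x.1 - y.1| ≤ ‖x - y‖ := norm_fst_le (x - y)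
  have h2 : |x.2 - y.2| ≤ ‖x - y‖ := norm_snd_le (x - y)
  have key : ∀ a b : ℝ, |a| ≤ 1 → |b| ≤ 1 →
      |(x.1 - y.1) * a + (x.2 - y.2) * b| ≤ 2 * ‖x - y‖ := by
    intro a b ha hb
    refine (abs_add_le _ _).trans ?_
    rw [abs_mul, abs_mul]
    have h3 := mul_le_mul h1 ha (abs_nonneg _) (norm_nonneg _)
    have h4 := mul_le_mul h2 hb (abs_nonneg _) (norm_nonneg _)
    linarith
  have hs := Real.abs_sin_le_one t
  have hc := Real.abs_cos_le_one t
  have hn := norm_nonneg (x - y)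
  rw [Prod.norm_def, add_mul]
  refine max_le ?_ ?_
  · have e : (toSlow q η t x - toSlow q η t y).1 =
        ((x.1 - y.1) * Real.sin t + (x.2 - y.2) * Real.cos t) / η ^ 2 := by
      simp only [toSlow, Prod.fst_sub]; ring
    rw [e, norm_div, Real.norm_eq_abs, Real.norm_of_nonneg (pow_pos hη 2).le]
    have h3 := div_le_div_of_nonneg_right (key _ _ hs hc) (pow_pos hη 2).le
    rw [mul_div_right_comm] at h3
    have : 0 ≤ 2 / η * ‖x - y‖ := by positivity
    linarith
  · have e : (toSlow q η t x - toSlow q η t y).2 =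
        ((x.1 - y.1) * Real.cos t + (x.2 - y.2) * -Real.sin t) / η := by
      simp only [toSlow, Prod.snd_sub]; ring
    rw [e, norm_div, Real.norm_eq_abs, Real.norm_of_nonneg hη.le]
    have h3 := div_le_div_of_nonneg_right (key _ (-Real.sin t) hc (by rwa [abs_neg])) hη.le
    rw [mul_div_right_comm] at h3
    have : 0 ≤ 2 / η ^ 2 * ‖x - y‖ := by positivity
    linarith

theorem toSlow_ofSlow (q : ℕ) {η : ℝ} (hη : η ≠ 0) (t : ℝ) (w : ℝ × ℝ) :
    toSlow q η t (ofSlow q η t w) = w := by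
  have h := Real.sin_sq_add_cos_sq t
  ext
  · simp only [toSlow, ofSlow, slowRadius]
    field_simp
    linear_combination (4 * (√2 + η ^ 2 * (w.1 - η ^ (2 * q) * Real.cos (2 * t) / 4))) * h
  · simp only [toSlow, ofSlow]
    field_simp
    linear_combination η * w.2 * h

theorem isAsympStable_ofSlow {q : ℕ} {η : ℝ} (hη : 0 < η) {W : ℝ → ℝ × ℝ}
    (hW : IsAsympStable (fun t w => η ^ (2 * q + 1) • slowField q η t w) W) :
    IsAsympStable (forcedRotation (q + 1) (η ^ (2 * q + 2))) fun t => ofSlow q η t (W t) := by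
  set C := 2 / η ^ 2 + 2 / η + (η ^ 2 + η)
  have hC : 0 < C := by positivity
  refine hW.of_lipschitz_conj hC fun y hy =>
    ⟨fun t => toSlow q η t (y t), fun t => hasDerivAt_toSlow hη.ne' (hy t), ?_, fun t => ?_⟩
  · have h := norm_toSlow_sub_le q hη 0 (y 0) (ofSlow q η 0 (W 0))
    rw [toSlow_ofSlow q hη.ne'] at h
    refine h.trans (mul_le_mul_of_nonneg_right ?_ (norm_nonneg _))
    exact le_add_of_nonneg_right (by positivity)
  · have h := norm_ofSlow_sub_le q hη t (toSlow q η t (y t)) (W t)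
    rw [ofSlow_toSlow q hη.ne'] at h
    refine h.trans (mul_le_mul_of_nonneg_right ?_ (norm_nonneg _))
    exact le_add_of_nonneg_left (by positivity)

theorem infDist_ofSlow_le (q : ℕ) {η : ℝ} (hη : 0 < η) (hη1 : η ≤ 1) (w : ℝ × ℝ) :
    Metric.infDist (ofSlow q η 0 w) {x : ℝ × ℝ | x.1 ^ 2 + x.2 ^ 2 = 2} ≤ η * (‖w‖ + 1) := by
  have hmem : ((0, √2) : ℝ × ℝ) ∈ {x : ℝ × ℝ | x.1 ^ 2 + x.2 ^ 2 = 2} := by simp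
  refine (Metric.infDist_le_dist_of_mem hmem).trans ?_
  have h1 : |w.1| ≤ ‖w‖ := norm_fst_le w
  have h2 : |w.2| ≤ ‖w‖ := norm_snd_le w
  have h3 : η ^ (2 * q) ≤ 1 := pow_le_one₀ hη.le hη1
  have h4 : 0 < η ^ (2 * q) := by positivity
  rw [dist_eq_norm, Prod.norm_def]
  refine max_le ?_ ?_
  · simp [ofSlow, abs_of_pos hη]
    nlinarith
  · simp [ofSlow, slowRadius, abs_of_pos hη]
    have h5 : |w.1 - η ^ (2 * q) / 4| ≤ ‖w‖ + 1 := by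
      obtain ⟨h6, h7⟩ := abs_le.1 h1
      exact abs_le.2 ⟨by linarith, by linarith⟩
    have h8 : η ^ 2 ≤ η := by nlinarith
    exact mul_le_mul h8 h5 (abs_nonneg _) hη.le

end OriginalCoordinates

/-- **Example 2, conclusion.**
For the system `ẋ₁ = x₂((1/4)(x₁²+x₂²-2)^p + 1)`,
`ẋ₂ = -x₁((1/4)(x₁²+x₂²-2)^p + 1) - ε²x₂ + ε sin t` (`p` a positive integer),
there exists `ε₀ > 0` such that for every `ε ∈ (0, ε₀]` the system has at least
one asymptotically stable `2π`-periodic solution `x_ε` whose initial condition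
`x_ε(0)` converges, as `ε → 0`, to the circle `{x : x₁² + x₂² = 2}` (the image
of the generating cycle `x₀(t) = (√2 sin t, √2 cos t)`). -/
theorem yagasaki_stable_periodic_solution
    (p : ℕ) (hp : 0 < p)
    (F : ℝ → ℝ → ℝ × ℝ → ℝ × ℝ)
    (hF : ∀ ε t x, F ε t x =
      (x.2 * ((1/4) * (x.1 ^ 2 + x.2 ^ 2 - 2) ^ p + 1),
       -x.1 * ((1/4) * (x.1 ^ 2 + x.2 ^ 2 - 2) ^ p + 1)
         - ε ^ 2 * x.2 + ε * Real.sin t)) :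
    ∃ ε₀ > 0, ∃ X : ℝ → ℝ → ℝ × ℝ,
      (∀ ε ∈ Ioc (0:ℝ) ε₀,
        IsSolution (F ε) (X ε) ∧
        Periodic (X ε) (2 * Real.pi) ∧
        IsAsympStable (F ε) (X ε)) ∧
      Tendsto (fun ε => Metric.infDist (X ε 0)
          {x : ℝ × ℝ | x.1 ^ 2 + x.2 ^ 2 = 2})
        (nhdsWithin 0 (Ioi 0)) (nhds 0) := by
  obtain ⟨q, rfl⟩ := Nat.exists_eq_succ_of_ne_zero hp.ne'
  have hF' : ∀ ε, F ε = forcedRotation (q + 1) ε := fun ε => by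
    funext t x; exact hF ε t x
  obtain ⟨w₀, η₀, hη₀, hW⟩ := exists_stable_periodic_slowField q
  choose! W hW using hW
  set r : ℝ → ℝ := fun ε => ε ^ ((2 * q + 2 : ℕ) : ℝ)⁻¹
  have hr : ∀ ε, 0 ≤ ε → r ε ^ (2 * q + 2) = ε := fun ε hε =>
    Real.rpow_inv_natCast_pow hε (by omega)
  have hr0 : ∀ ε, 0 < ε → 0 < r ε := fun ε hε => Real.rpow_pos_of_pos hε _
  set η₁ := min η₀ 1
  have hη₁ : 0 < η₁ := lt_min hη₀ one_pos
  have hrle : ∀ ε ∈ Ioc 0 (η₁ ^ (2 * q + 2)), r ε ∈ Ioc 0 η₁ := fun ε hε =>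
    ⟨hr0 ε hε.1, (pow_le_pow_iff_left₀ (hr0 ε hε.1).le hη₁.le (by omega : 2 * q + 2 ≠ 0)).1
      (by rw [hr ε hε.1.le]; exact hε.2)⟩
  refine ⟨η₁ ^ (2 * q + 2), by positivity, fun ε t => ofSlow q (r ε) t (W (r ε) t),
    fun ε hε => ?_, ?_⟩
  · obtain ⟨hpos, hle⟩ := hrle ε hε
    obtain ⟨hsol, hper, hstab, -⟩ := hW (r ε) ⟨hpos, hle.trans (min_le_left _ _)⟩
    have e : F ε = forcedRotation (q + 1) (r ε ^ (2 * q + 2)) := by rw [hF', hr ε hε.1.le]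
    rw [e]
    refine ⟨fun t => hasDerivAt_ofSlow (hsol t), fun t => ?_, isAsympStable_ofSlow hpos hstab⟩
    simp only [ofSlow_add_two_pi, hper t]
  · have hlim : Tendsto (fun ε => r ε * (‖w₀‖ + 2)) (nhdsWithin 0 (Ioi 0)) (nhds 0) := by
      have hc : Continuous r := Real.continuous_rpow_const (by positivity)
      have h0 : r 0 = 0 := Real.zero_rpow (by positivity)
      have := ((hc.tendsto 0).mono_left (nhdsWithin_le_nhds (s := Ioi 0))).mul_const (‖w₀‖ + 2)
      rwa [h0, zero_mul] at this
    refine squeeze_zero' (Eventually.of_forall fun _ => Metric.infDist_nonneg) ?_ hlim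
    filter_upwards [Ioc_mem_nhdsGT (show 0 < η₁ ^ (2 * q + 2) by positivity)] with ε hε
    obtain ⟨hpos, hle⟩ := hrle ε hε
    obtain ⟨-, -, -, hnear⟩ := hW (r ε) ⟨hpos, hle.trans (min_le_left _ _)⟩
    refine (infDist_ofSlow_le q hpos (hle.trans (min_le_right _ _)) _).trans ?_
    have h1 := norm_add_le (W (r ε) 0 - w₀) w₀
    rw [sub_add_cancel] at h1
    exact mul_le_mul_of_nonneg_left (by linarith) hpos.le
end
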